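/- arXiv:2112.12915 — 2 statements merged into one kernel-verified Lean document; each statement's English description precedes it below -/
import Mathlib

section
/- The reduced cohomology of the Schrödinger-Virasoro conformal algebra with trivial coefficients has the following explicit bases: H⁰(SV,ℂ) = ℂ; H²(SV,ℂ) = ℂ(Φ̄) with Φ̄_{λ₁,λ₂}(L,L) = −λ₁³+λ₂³; H³(SV,ℂ) = ℂ(Φ) with Φ_{λ₁,λ₂,λ₃}(L,L,L) = (λ₁−λ₂)(λ₁−λ₃)(λ₂−λ₃); H⁴(SV,ℂ) = ℂ(Λ̄) ⊕ ℂ(Ψ̄) with Λ̄_{λ₁,…,λ₄}(L,Y,Y,M) = (λ₂+λ₃+λ₄)(λ₂−λ₃)λ₄ and Ψ̄_{λ₁,…,λ₄}(Y,Y,M,M) = (λ₁−λ₂)(λ₃−λ₄); H⁵(SV,ℂ) = ℂ(Λ) ⊕ ℂ(Ψ) ⊕ ℂ(Ω̄) ⊕ ℂ(Θ̄) with Λ_{λ₁,…,λ₅}(L,L,Y,Y,M) = (λ₁−λ₂)(λ₃−λ₄)λ₅, Ψ_{λ₁,…,λ₅}(L,Y,Y,M,M) = (λ₂−λ₃)(λ₄−λ₅),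 Ω̄_{λ₁,…,λ₅}(L,L,Y,Y,M) = (λ₁−λ₂)(λ₃−λ₄)(λ₁λ₂−(λ₁+λ₂)(λ₁+λ₂+λ₃+λ₄+λ₅)) and Θ̄_{λ₁,…,λ₅}(L,Y,Y,M,M) = (λ₂−λ₃)(λ₄−λ₅)(λ₂+λ₃+λ₄+λ₅); H⁶(SV,ℂ) = ℂ(Ω) ⊕ ℂ(Θ) with Ω_{λ₁,…,λ₆}(L,L,L,Y,Y,M) = (λ₁−λ₂)(λ₁−λ₃)(λ₂−λ₃)(λ₄−λ₅) and Θ_{λ₁,…,λ₆}(L,L,Y,Y,M,M) = (λ₁−λ₂)(λ₃−λ₄)(λ₅−λ₆); and H^q(SV,ℂ) = 0 otherwise. Each listed cochain is zero on all tuples of generators other than the one displayed. -/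
/-!
Cochain complex of the Schrödinger–Virasoro conformal algebra
`SV = ℂ[∂]L ⊕ ℂ[∂]Y ⊕ ℂ[∂]M` with coefficients in the trivial module `ℂ_a`.

Since `SV` is a free `ℂ[∂]`-module on the generators `L, Y, M`, and since a
`q`-cochain (a `ℂ`-linear, conformally antilinear map `SV^{⊗q} → ℂ[λ₁,…,λ_q]`)
is uniquely determined by its values on `q`-tuples of generators, we model
cochains as functions from generator tuples to `ℂ[λ₁,…,λ_q]`, subject to the
skew-symmetry condition (simultaneous permutation of the entries and the
variables `λᵢ`).
-/

namespace SVCA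

open MvPolynomial

/-- The generators `L`, `Y`, `M` of the Schrödinger–Virasoro conformal algebra. -/
inductive SVGen : Type
  | L | Y | M
  deriving DecidableEq

open SVGen

/-- The λ-brackets on generators: `SVbrk a b = (x, c₁, c₂)` encodes
`[a_λ b] = (c₁ ∂ + c₂ λ) x`.  Zero brackets are encoded by zero coefficients:
`[L_λ L] = (∂+2λ)L`, `[L_λ Y] = (∂+(3/2)λ)Y`, `[Y_λ L] = ((1/2)∂+(3/2)λ)Y`,
`[Y_λ Y] = (∂+2λ)M`, `[L_λ M] = (∂+λ)M`, `[M_λ L] = λM`, and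
`[Y_λ M] = [M_λ Y] = [M_λ M] = 0`. -/
noncomputable def SVbrk : SVGen → SVGen → SVGen × ℂ × ℂ
  | L, L => (L, 1, 2)
  | L, Y => (Y, 1, 3/2)
  | Y, L => (Y, 1/2, 3/2)
  | Y, Y => (M, 1, 2)
  | L, M => (M, 1, 1)
  | M, L => (M, 0, 1)
  | _, _ => (M, 0, 0)

/-- The space of (not necessarily skew-symmetric) `q`-cochains with trivial
coefficients: functions from `q`-tuples of generators to `ℂ[λ₁,…,λ_q]`. -/
abbrev SVRaw (q : ℕ) := (Fin q → SVGen) → MvPolynomial (Fin q) ℂ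

/-- The `ℂ`-subspace `C̃^q(SV,ℂ)` of `q`-cochains: skew-symmetry with respect to
simultaneous permutations of the arguments and of the variables `λᵢ`. -/
noncomputable def SVCochain (q : ℕ) : Submodule ℂ (SVRaw q) where
  carrier := {c | ∀ (σ : Equiv.Perm (Fin q)) (a : Fin q → SVGen),
      rename σ (c (a ∘ σ)) = ((Equiv.Perm.sign σ : ℤ) : ℂ) • c a}
  add_mem' := by
    intro c c' hc hc' σ a
    simp only [Pi.add_apply, map_add, hc σ a, hc' σ a, smul_add]
  zero_mem' := by intro σ a; simp
  smul_mem' := by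
    intro r c hc σ a
    simp only [Pi.smul_apply, map_smul, hc σ a]
    rw [smul_comm]

/-- The strictly increasing embedding `Fin q → Fin (q+2)` omitting `i` and `j`
(meaningful for `i < j`; junk otherwise). -/
def SVskip {q : ℕ} (i j : Fin (q + 2)) (k : Fin q) : Fin (q + 2) :=
  j.succAbove ((⟨min (i : ℕ) q, Nat.lt_succ_of_le (Nat.min_le_right _ _)⟩ : Fin (q + 1)).succAbove k)

/-- The `(i,j)`-summand of the differential (trivial coefficients):
`(-1)^{i+j} γ_{λᵢ+λⱼ, λ₁, …, λ̂ᵢ, …, λ̂ⱼ, …}([a_{i λᵢ} a_j], a₁, …, âᵢ, …, âⱼ, …)`,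
where `[a_{i λᵢ} a_j] = (c₁∂ + c₂λᵢ)x` and conformal antilinearity in the first
slot (whose variable is `λᵢ+λⱼ`) produces the factor `c₂λᵢ - c₁(λᵢ+λⱼ)`. -/
noncomputable def SVdTerm {q : ℕ} (c : SVRaw (q + 1)) (a : Fin (q + 2) → SVGen)
    (i j : Fin (q + 2)) : MvPolynomial (Fin (q + 2)) ℂ :=
  ((-1 : ℂ) ^ ((i : ℕ) + (j : ℕ))) •
    ((C (SVbrk (a i) (a j)).2.2 * X i - C (SVbrk (a i) (a j)).2.1 * (X i + X j)) *
      aeval (Fin.cons (X i + X j) fun k => X (SVskip i j k))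
        (c (Fin.cons (SVbrk (a i) (a j)).1 fun k => a (SVskip i j k))))

/-- The differential `d_q : C̃^q → C̃^{q+1}` (trivial coefficients). -/
noncomputable def SVd : {q : ℕ} → SVRaw q → SVRaw (q + 1)
  | 0, _ => 0
  | (q + 1), c => fun a =>
      ∑ i : Fin (q + 2), ∑ j : Fin (q + 2),
        if (i : ℕ) < (j : ℕ) then SVdTerm c a i j else 0

lemma SVdTerm_add {q : ℕ} (c c' : SVRaw (q + 1)) (a : Fin (q + 2) → SVGen)
    (i j : Fin (q + 2)) :
    SVdTerm (c + c') a i j = SVdTerm c a i j + SVdTerm c' a i j := by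
  simp [SVdTerm, mul_add, smul_add]

lemma SVdTerm_smul {q : ℕ} (r : ℂ) (c : SVRaw (q + 1)) (a : Fin (q + 2) → SVGen)
    (i j : Fin (q + 2)) :
    SVdTerm (r • c) a i j = r • SVdTerm c a i j := by
  simp only [SVdTerm, Pi.smul_apply, map_smul, mul_smul_comm]
  rw [smul_comm]

/-- The differential as a `ℂ`-linear map. -/
noncomputable def SVdLin (q : ℕ) : SVRaw q →ₗ[ℂ] SVRaw (q + 1) where
  toFun := SVd
  map_add' c c' := by
    cases q with
    | zero => simp [SVd]
    | succ q =>
      funext a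
      simp only [SVd, Pi.add_apply]
      rw [← Finset.sum_add_distrib]
      refine Finset.sum_congr rfl fun i _ => ?_
      rw [← Finset.sum_add_distrib]
      refine Finset.sum_congr rfl fun j _ => ?_
      by_cases h : (i : ℕ) < (j : ℕ)
      · simp [h, SVdTerm_add]
      · simp [h]
  map_smul' r c := by
    cases q with
    | zero => simp [SVd]
    | succ q =>
      funext a
      simp only [SVd, RingHom.id_apply, Pi.smul_apply, Finset.smul_sum]
      refine Finset.sum_congr rfl fun i _ => ?_
      refine Finset.sum_congr rfl fun j _ => ?_
      by_cases h : (i : ℕ) < (j : ℕ)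
      · simp [h, SVdTerm_smul]
      · simp [h]

/-- The space `D̃^q(SV,ℂ)` of `q`-cocycles: skew-symmetric cochains with `dγ = 0`. -/
noncomputable def SVcocycles (q : ℕ) : Submodule ℂ (SVRaw q) :=
  SVCochain q ⊓ LinearMap.ker (SVdLin q)

/-- The space `B̃^q(SV,ℂ)` of `q`-coboundaries: differentials of `(q-1)`-cochains
(`0` for `q = 0`). -/
noncomputable def SVcoboundaries : (q : ℕ) → Submodule ℂ (SVRaw q)
  | 0 => ⊥
  | (q + 1) => Submodule.map (SVdLin q) (SVCochain q)

/-- The basic cohomology `H̃^q(SV,ℂ)` = cocycles / coboundaries. -/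
noncomputable def SVbasicH (q : ℕ) :=
  SVcocycles q ⧸ Submodule.comap (SVcocycles q).subtype (SVcoboundaries q)


noncomputable instance (q : ℕ) : AddCommGroup (SVbasicH q) := by
  unfold SVbasicH; infer_instance
noncomputable instance (q : ℕ) : Module ℂ (SVbasicH q) := by
  unfold SVbasicH; infer_instance

/-- The action of `∂` on `q`-cochains with coefficients in `ℂ_a`:
`(∂γ)_{λ₁,…,λ_q} = (a + λ₁ + ⋯ + λ_q)·γ_{λ₁,…,λ_q}`.  (The trivial module `ℂ`
is the case `a = 0`.) -/
noncomputable def SVpartial (a : ℂ) (q : ℕ) : SVRaw q →ₗ[ℂ] SVRaw q where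
  toFun c := fun t => (C a + ∑ i, X i) * c t
  map_add' c c' := by funext t; simp [mul_add]
  map_smul' r c := by funext t; simp [mul_smul_comm]

/-- The subspace `∂C̃^q ⊆ C̃^q` (with coefficients in `ℂ_a`). -/
noncomputable def SVpartialSub (a : ℂ) (q : ℕ) : Submodule ℂ (SVRaw q) :=
  Submodule.map (SVpartial a q) (SVCochain q)

/-- `q`-cochains representing reduced `q`-cocycles: cochains `γ` with
`dγ ∈ ∂C̃^{q+1}` (these are exactly the representatives of `ker d̄`
in the quotient complex `C̃^•/∂C̃^•`). -/
noncomputable def SVredCocycles (a : ℂ) (q : ℕ) : Submodule ℂ (SVRaw q) :=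
  SVCochain q ⊓ Submodule.comap (SVdLin q) (SVpartialSub a (q + 1))

/-- `q`-cochains representing reduced `q`-coboundaries: `∂C̃^q + dC̃^{q-1}`
(these are exactly the representatives of `im d̄` in the quotient complex). -/
noncomputable def SVredCoboundaries (a : ℂ) : (q : ℕ) → Submodule ℂ (SVRaw q)
  | 0 => SVpartialSub a 0
  | (q + 1) => SVpartialSub a (q + 1) ⊔ Submodule.map (SVdLin q) (SVCochain q)

/-- The reduced cohomology `H^q(SV,ℂ_a)`, realized (via the third isomorphism
theorem) as `{γ ∈ C̃^q : dγ ∈ ∂C̃^{q+1}} / (∂C̃^q + dC̃^{q-1})`. -/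
noncomputable def SVredH (a : ℂ) (q : ℕ) :=
  SVredCocycles a q ⧸ Submodule.comap (SVredCocycles a q).subtype (SVredCoboundaries a q)


noncomputable instance (a : ℂ) (q : ℕ) : AddCommGroup (SVredH a q) := by
  unfold SVredH; infer_instance
noncomputable instance (a : ℂ) (q : ℕ) : Module ℂ (SVredH a q) := by
  unfold SVredH; infer_instance

/-- The cocycles of the subcomplex `∂C̃^•` (trivial coefficients `ℂ`). -/
noncomputable def SVsubCocycles (q : ℕ) : Submodule ℂ (SVRaw q) :=
  SVpartialSub 0 q ⊓ LinearMap.ker (SVdLin q)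

/-- The coboundaries of the subcomplex `∂C̃^•` (trivial coefficients `ℂ`). -/
noncomputable def SVsubCoboundaries : (q : ℕ) → Submodule ℂ (SVRaw q)
  | 0 => ⊥
  | (q + 1) => Submodule.map (SVdLin q) (SVpartialSub 0 q)

/-- The cohomology `H^q(∂C̃^•)` of the subcomplex `∂C̃^•` (trivial coefficients). -/
noncomputable def SVsubH (q : ℕ) :=
  SVsubCocycles q ⧸ Submodule.comap (SVsubCocycles q).subtype (SVsubCoboundaries q)


noncomputable instance (q : ℕ) : AddCommGroup (SVsubH q) := by
  unfold SVsubH; infer_instance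
noncomputable instance (q : ℕ) : Module ℂ (SVsubH q) := by
  unfold SVsubH; infer_instance

/-- The operator `τ`:
`(τγ)_{λ₁,…,λ_{q-1}}(a₁,…,a_{q-1}) = (-1)^{q-1} ∂/∂λ γ_{λ₁,…,λ_{q-1},λ}(a₁,…,a_{q-1},L)|_{λ=0}`. -/
noncomputable def SVtau {q : ℕ} (c : SVRaw (q + 1)) : SVRaw q := fun a =>
  ((-1 : ℂ) ^ q) •
    aeval (Fin.snoc (fun i : Fin q => X i) 0)
      (pderiv (Fin.last q) (c (Fin.snoc a SVGen.L)))

/-- The operator `τ₂`: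
`(τ₂γ)_{λ₁,…,λ_{q-1}}(a₁,…,a_{q-1}) = (-1)^{q-1} γ_{λ₁,…,λ_{q-1},λ}(a₁,…,a_{q-1},L)|_{λ=0}`. -/
noncomputable def SVtau2 {q : ℕ} (c : SVRaw (q + 1)) : SVRaw q := fun a =>
  ((-1 : ℂ) ^ q) • aeval (Fin.snoc (fun i : Fin q => X i) 0) (c (Fin.snoc a SVGen.L))

/-- The tuple with `k` copies of `L`, then `l` copies of `Y`, then copies of `M`. -/
def SVtuple (q k l : ℕ) : Fin q → SVGen := fun i =>
  if (i : ℕ) < k then SVGen.L else if (i : ℕ) < k + l then SVGen.Y else SVGen.M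

/-- `∏_{i<j ∈ s} (λᵢ - λⱼ)`. -/
noncomputable def SVvandermonde (q : ℕ) (s : Finset (Fin q)) : MvPolynomial (Fin q) ℂ :=
  ∏ p ∈ (s ×ˢ s).filter fun p => p.1 < p.2, (X p.1 - X p.2)

open SVGen in
/-- The `2`-cochain `Φ̄`, with `Φ̄_{λ₁,λ₂}(L,L) = -λ₁³+λ₂³`, zero on the other
pairs of generators. -/
noncomputable def SVPhiBar : SVRaw 2 := fun a =>
  if a = ![L, L] then -(X 0) ^ 3 + (X 1) ^ 3 else 0

open SVGen in
/-- The `3`-cochain `Φ`, with `Φ_{λ₁,λ₂,λ₃}(L,L,L) = (λ₁-λ₂)(λ₁-λ₃)(λ₂-λ₃)`,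
zero on all other triples of generators. -/
noncomputable def SVPhi : SVRaw 3 := fun a =>
  if a = ![L, L, L] then (X 0 - X 1) * (X 0 - X 2) * (X 1 - X 2) else 0


/-! ### The differential on functions of basis elements of the annihilation algebra -/

open SVGen

/-- The basis elements of the annihilation Lie algebra: `(a, n)` stands for the coefficient of
`λⁿ / n!`. -/
abbrev BasisElt := SVGen × ℕ

/-- Twice the λ-bracket, with integer coefficients: `(x, c₁, c₂)` encodes
`2 [a_λ b] = (c₁ ∂ + c₂ λ) x`. -/
def doubledBracket : SVGen → SVGen → SVGen × ℤ × ℤ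
  | L, L => (L, 2, 4)
  | L, Y => (Y, 2, 3)
  | Y, L => (Y, 1, 3)
  | Y, Y => (M, 2, 4)
  | L, M => (M, 2, 2)
  | M, L => (M, 0, 2)
  | _, _ => (M, 0, 0)

/-- Twice the structure constant of the bracket of two basis elements. -/
def lieCoef (x y : BasisElt) : ℤ :=
  (doubledBracket x.1 y.1).2.2 * x.2 - (doubledBracket x.1 y.1).2.1 * (x.2 + y.2)

/-- The basis element to which the bracket of two basis elements is proportional. -/
def lieElt (x y : BasisElt) : BasisElt := ((doubledBracket x.1 y.1).1, x.2 + y.2 - 1)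

lemma lieCoef_swap (x y : BasisElt) : lieCoef y x = -lieCoef x y := by
  obtain ⟨a, n⟩ := x
  obtain ⟨b, m⟩ := y
  cases a <;> cases b <;> simp [lieCoef, doubledBracket] <;> ring

lemma lieElt_swap (x y : BasisElt) : lieElt y x = lieElt x y := by
  obtain ⟨a, n⟩ := x
  obtain ⟨b, m⟩ := y
  cases a <;> cases b <;> simp [lieElt, doubledBracket, add_comm]

lemma lieCoef_eq_zero_of_index (x y : BasisElt) (h : x.2 + y.2 = 0) : lieCoef x y = 0 := by
  have h1 : x.2 = 0 := by omega
  have h2 : y.2 = 0 := by omega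
  simp [lieCoef, h1, h2]

/-- The Jacobi identity on basis elements. -/
lemma lie_jacobi (x y z : BasisElt) (f : BasisElt → ℂ) :
    (lieCoef x z * lieCoef y (lieElt x z) : ℂ) * f (lieElt y (lieElt x z)) -
      (lieCoef y z * lieCoef x (lieElt y z) : ℂ) * f (lieElt x (lieElt y z)) =
      -((lieCoef x y * lieCoef (lieElt x y) z : ℂ) * f (lieElt (lieElt x y) z)) := by
  have key : ∀ u v w : ℕ, ∀ c : ℤ, (u + v = 0 → c = 0) → ∀ g : ℤ → ℕ → ℂ,
      (c : ℂ) * g ((u + v - 1 : ℕ) : ℤ) (w + (u + v - 1) - 1) =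
        c * g ((u : ℤ) + v - 1) (u + v + w - 2) := by
    intro u v w c hc g
    rcases Nat.eq_zero_or_pos (u + v) with h | h
    · simp [hc h]
    · have h1 : ((u + v - 1 : ℕ) : ℤ) = (u : ℤ) + v - 1 := by omega
      have h2 : w + (u + v - 1) - 1 = u + v + w - 2 := by omega
      rw [h1, h2]
  have h1 := key x.2 z.2 y.2 (lieCoef x z) (lieCoef_eq_zero_of_index x z) fun i j =>
    (((doubledBracket y.1 (lieElt x z).1).2.2 * y.2 -
      (doubledBracket y.1 (lieElt x z).1).2.1 * (y.2 + i) : ℤ) : ℂ) *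
      f ((doubledBracket y.1 (lieElt x z).1).1, j)
  have h2 := key y.2 z.2 x.2 (lieCoef y z) (lieCoef_eq_zero_of_index y z) fun i j =>
    (((doubledBracket x.1 (lieElt y z).1).2.2 * x.2 -
      (doubledBracket x.1 (lieElt y z).1).2.1 * (x.2 + i) : ℤ) : ℂ) *
      f ((doubledBracket x.1 (lieElt y z).1).1, j)
  have h3 := key x.2 y.2 z.2 (lieCoef x y) (lieCoef_eq_zero_of_index x y) fun i j =>
    (((doubledBracket (lieElt x y).1 z.1).2.2 * i -
      (doubledBracket (lieElt x y).1 z.1).2.1 * (i + z.2) : ℤ) : ℂ) *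
      f ((doubledBracket (lieElt x y).1 z.1).1, j)
  have e1 : y.2 + z.2 + x.2 - 2 = x.2 + z.2 + y.2 - 2 := by omega
  have e2 : x.2 + y.2 + z.2 - 2 = x.2 + z.2 + y.2 - 2 := by omega
  have e3 : x.2 + y.2 - 1 + z.2 - 1 = z.2 + (x.2 + y.2 - 1) - 1 := by omega
  rw [e1] at h2
  rw [e2, ← e3] at h3
  have h1' : (lieCoef x z * lieCoef y (lieElt x z) : ℂ) * f (lieElt y (lieElt x z)) = _ :=
    (mul_assoc _ _ _).trans h1
  have h2' : (lieCoef y z * lieCoef x (lieElt y z) : ℂ) * f (lieElt x (lieElt y z)) = _ :=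
    (mul_assoc _ _ _).trans h2
  have h3' : (lieCoef x y * lieCoef (lieElt x y) z : ℂ) * f (lieElt (lieElt x y) z) = _ :=
    (mul_assoc _ _ _).trans h3
  rw [h1', h2', h3']
  obtain ⟨a, n⟩ := x
  obtain ⟨b, m⟩ := y
  obtain ⟨c, k⟩ := z
  cases a <;> cases b <;> cases c <;>
    simp only [lieElt, lieCoef, doubledBracket] <;> push_cast <;> ring

/-- Inhomogeneous cochains, as functions on words of basis elements. -/
abbrev WordCochain := List BasisElt → ℂ

/-- Insertion of a basis element in the first slot. -/
def contract (x : BasisElt) : WordCochain →ₗ[ℂ] WordCochain where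
  toFun F l := F (x :: l)
  map_add' _ _ := rfl
  map_smul' _ _ := rfl

lemma contract_apply (x : BasisElt) (F : WordCochain) (l : List BasisElt) :
    contract x F l = F (x :: l) := rfl

/-- The Lie derivative, evaluated on a word. -/
noncomputable def lieDerAux (x : BasisElt) : List BasisElt → WordCochain → ℂ
  | [], _ => 0
  | y :: l, F => -((lieCoef x y : ℂ) / 2) * F (lieElt x y :: l) + lieDerAux x l (contract y F)

/-- The Lie derivative along a basis element. -/
noncomputable def lieDer (x : BasisElt) : WordCochain →ₗ[ℂ] WordCochain where
  toFun F l := lieDerAux x l F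
  map_add' F G := by
    funext l
    induction l generalizing F G with
    | nil => simp [lieDerAux]
    | cons y l ih =>
      simp only [Pi.add_apply] at ih ⊢
      simp only [lieDerAux, map_add, ih, Pi.add_apply]
      ring
  map_smul' r F := by
    funext l
    induction l generalizing F with
    | nil => simp [lieDerAux]
    | cons y l ih =>
      simp only [Pi.smul_apply, smul_eq_mul, RingHom.id_apply] at ih ⊢
      simp only [lieDerAux, map_smul, ih, Pi.smul_apply, smul_eq_mul]
      ring

lemma lieDer_nil (x : BasisElt) (F : WordCochain) : lieDer x F [] = 0 := rfl

lemma lieDer_cons (x y : BasisElt) (F : WordCochain) (l : List BasisElt) :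
    lieDer x F (y :: l) =
      -((lieCoef x y : ℂ) / 2) * F (lieElt x y :: l) + lieDer x (contract y F) l := rfl

/-- The differential, evaluated on a word. -/
noncomputable def wordDiffAux : List BasisElt → WordCochain → ℂ
  | [], _ => 0
  | x :: l, F => lieDer x F l - wordDiffAux l (contract x F)

/-- The Chevalley–Eilenberg differential, defined through the Cartan formula. -/
noncomputable def wordDiff : WordCochain →ₗ[ℂ] WordCochain where
  toFun F l := wordDiffAux l F
  map_add' F G := by
    funext l
    induction l generalizing F G with
    | nil => simp [wordDiffAux]
    | cons y l ih =>
      simp only [Pi.add_apply] at ih ⊢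
      simp only [wordDiffAux, map_add, ih, Pi.add_apply]
      ring
  map_smul' r F := by
    funext l
    induction l generalizing F with
    | nil => simp [wordDiffAux]
    | cons y l ih =>
      simp only [Pi.smul_apply, smul_eq_mul, RingHom.id_apply] at ih ⊢
      simp only [wordDiffAux, map_smul, ih, Pi.smul_apply, smul_eq_mul]
      ring

lemma wordDiff_nil (F : WordCochain) : wordDiff F [] = 0 := rfl

lemma wordDiff_cons (x : BasisElt) (F : WordCochain) (l : List BasisElt) :
    wordDiff F (x :: l) = lieDer x F l - wordDiff (contract x F) l := rfl

lemma contract_wordDiff (x : BasisElt) (F : WordCochain) :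
    contract x (wordDiff F) = lieDer x F - wordDiff (contract x F) := rfl

lemma contract_lieDer (x y : BasisElt) (F : WordCochain) :
    contract y (lieDer x F) =
      -((lieCoef x y : ℂ) / 2) • contract (lieElt x y) F + lieDer x (contract y F) := rfl

lemma lieDer_comm (x y : BasisElt) (F : WordCochain) :
    lieDer x (lieDer y F) - lieDer y (lieDer x F) =
      ((lieCoef x y : ℂ) / 2) • lieDer (lieElt x y) F := by
  funext l
  induction l generalizing F with
  | nil => simp [lieDer_nil]
  | cons z l ih =>
    have h := ih (contract z F)
    have j := lie_jacobi x y z fun w => F (w :: l)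
    simp only [Pi.sub_apply, Pi.smul_apply, smul_eq_mul] at h ⊢
    simp only [lieDer_cons, contract_lieDer, map_add, map_smul, Pi.add_apply, Pi.smul_apply,
      smul_eq_mul]
    linear_combination h + j / 4

lemma lieDer_wordDiff (x : BasisElt) (F : WordCochain) :
    lieDer x (wordDiff F) = wordDiff (lieDer x F) := by
  funext l
  induction l generalizing F x with
  | nil => simp [lieDer_nil, wordDiff_nil]
  | cons y l ih =>
    have h := ih x (contract y F)
    have c := congrFun (lieDer_comm x y F) l
    simp only [Pi.sub_apply, Pi.smul_apply, smul_eq_mul] at c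
    simp only [lieDer_cons, wordDiff_cons, contract_wordDiff, contract_lieDer, map_add, map_sub,
      map_smul, Pi.add_apply, Pi.sub_apply, Pi.smul_apply, smul_eq_mul]
    linear_combination c - h

lemma wordDiff_wordDiff (F : WordCochain) : wordDiff (wordDiff F) = 0 := by
  funext l
  induction l generalizing F with
  | nil => rfl
  | cons x l ih =>
    have h := ih (contract x F)
    have c := congrFun (lieDer_wordDiff x F) l
    simp only [Pi.zero_apply] at h ⊢
    simp only [wordDiff_cons, contract_wordDiff, map_sub, Pi.sub_apply]
    linear_combination c + h

/-- Skew-symmetry of a word cochain, in terms of adjacent transpositions. -/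
def IsSkew (F : WordCochain) : Prop :=
  ∀ l₁ x y l₂, F (l₁ ++ x :: y :: l₂) = -F (l₁ ++ y :: x :: l₂)

namespace IsSkew

variable {F G : WordCochain}

protected lemma contract (hF : IsSkew F) (x : BasisElt) : IsSkew (contract x F) :=
  fun l₁ y z l₂ => hF (x :: l₁) y z l₂

lemma contract_contract (hF : IsSkew F) (x y : BasisElt) :
    contract x (contract y F) = -contract y (contract x F) :=
  funext fun l => hF [] y x l

protected lemma lieDer (hF : IsSkew F) (x : BasisElt) : IsSkew (lieDer x F) := by
  intro l₁ y z l₂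
  induction l₁ generalizing F with
  | nil =>
    have h1 := hF [] (lieElt x y) z l₂
    have h2 := hF [] y (lieElt x z) l₂
    have h3 := congrFun (congrArg (SVCA.lieDer x) (hF.contract_contract y z)) l₂
    simp only [map_neg, Pi.neg_apply, List.nil_append] at h1 h2 h3 ⊢
    simp only [lieDer_cons, contract_apply, h1, h2, h3]
    ring
  | cons w l₁ ih =>
    have h1 := hF (lieElt x w :: l₁) y z l₂
    have h2 := ih (hF.contract w)
    simp only [List.cons_append] at h1 ⊢
    rw [lieDer_cons, lieDer_cons, h1, h2]
    ring

protected lemma wordDiff (hF : IsSkew F) : IsSkew (wordDiff F) := by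
  intro l₁ y z l₂
  induction l₁ generalizing F with
  | nil =>
    have h3 := congrFun (congrArg SVCA.wordDiff (hF.contract_contract y z)) l₂
    simp only [map_neg, Pi.neg_apply, List.nil_append] at h3 ⊢
    simp only [wordDiff_cons, lieDer_cons, h3, lieElt_swap y z, lieCoef_swap y z]
    push_cast
    ring
  | cons w l₁ ih =>
    have h1 := hF.lieDer w l₁ y z l₂
    have h2 := ih (hF.contract w)
    simp only [List.cons_append]
    rw [wordDiff_cons, wordDiff_cons, h1, h2]
    ring

lemma eq_zero_of_perm {l l' : List BasisElt} (h : l.Perm l') (hF : IsSkew F) (h0 : F l = 0) :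
    F l' = 0 := by
  induction h generalizing F with
  | nil => exact h0
  | cons x _ ih => exact ih (hF.contract x) h0
  | swap x y l =>
    have := hF [] x y l
    simp_all
  | trans _ _ ih₁ ih₂ => exact ih₂ hF (ih₁ hF h0)

lemma eq_zero_of_not_nodup {l : List BasisElt} (hF : IsSkew F) (h : ¬ l.Nodup) : F l = 0 := by
  rw [List.nodup_iff_sublist] at h
  push Not at h
  obtain ⟨x, hx⟩ := h
  obtain ⟨l', hl'⟩ := hx.exists_perm_append
  refine eq_zero_of_perm hl'.symm hF ?_
  have := hF [] x x l'
  simp only [List.nil_append] at this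
  exact self_eq_neg.mp this

end IsSkew

/-- A numbering of the basis elements of small weight. -/
def sortKey : BasisElt → ℕ
  | (L, n) => n
  | (Y, n) => 10 + n
  | (M, n) => 20 + n

/-- Ordered insertion, together with its sign. -/
def signedInsert (x : BasisElt) : List BasisElt → ℤ × List BasisElt
  | [] => (1, [x])
  | y :: l =>
    if sortKey x ≤ sortKey y then (1, x :: y :: l)
    else (-(signedInsert x l).1, y :: (signedInsert x l).2)

/-- Insertion sort, together with its sign. -/
def signedSort : List BasisElt → ℤ × List BasisElt
  | [] => (1, [])
  | x :: l =>
    ((signedSort l).1 * (signedInsert x (signedSort l).2).1,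
      (signedInsert x (signedSort l).2).2)

lemma IsSkew.apply_signedInsert {F : WordCochain} (hF : IsSkew F) (x : BasisElt)
    (l : List BasisElt) : F (x :: l) = (signedInsert x l).1 * F (signedInsert x l).2 := by
  induction l generalizing F with
  | nil => simp [signedInsert]
  | cons y l ih =>
    unfold signedInsert
    split_ifs with h
    · simp
    · have h1 := hF [] x y l
      have h2 := ih (hF.contract y)
      simp only [List.nil_append, contract_apply] at h1 h2
      rw [h1, h2]
      push_cast
      ring

lemma IsSkew.apply_signedSort {F : WordCochain} (hF : IsSkew F) (l : List BasisElt) :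
    F l = (signedSort l).1 * F (signedSort l).2 := by
  induction l generalizing F with
  | nil => simp [signedSort]
  | cons x l ih =>
    have h := ih (hF.contract x)
    simp only [contract_apply] at h
    rw [h, hF.apply_signedInsert x (signedSort l).2, signedSort]
    push_cast
    ring

/-- The value of twice a Lie derivative on a word, as a formal integral combination of words. -/
def lieDerRow (x : BasisElt) : List BasisElt → List (ℤ × List BasisElt)
  | [] => []
  | y :: l => (-lieCoef x y, lieElt x y :: l) :: (lieDerRow x l).map fun p => (p.1, y :: p.2)

/-- The value of twice the differential on a word, as a formal integral combination of words. -/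
def wordDiffRow : List BasisElt → List (ℤ × List BasisElt)
  | [] => []
  | x :: l => lieDerRow x l ++ (wordDiffRow l).map fun p => (-p.1, x :: p.2)

/-- The linear combination of the values of a word cochain. -/
noncomputable def rowSum (F : WordCochain) (r : List (ℤ × List BasisElt)) : ℂ :=
  (r.map fun p => (p.1 : ℂ) * F p.2).sum

/-- Sort all words of a formal combination and drop those with vanishing contribution. -/
def normalizeRow (r : List (ℤ × List BasisElt)) : List (ℤ × List BasisElt) :=
  (r.filter fun p => p.1 ≠ 0 ∧ p.2.Nodup).map fun p =>
    (p.1 * (signedSort p.2).1, (signedSort p.2).2)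

lemma rowSum_lieDerRow (x : BasisElt) (F : WordCochain) (l : List BasisElt) :
    2 * lieDer x F l = rowSum F (lieDerRow x l) := by
  induction l generalizing F with
  | nil => simp [lieDer_nil, lieDerRow, rowSum]
  | cons y l ih =>
    have h := ih (contract y F)
    simp only [rowSum] at h
    simp only [lieDer_cons, mul_add, h, rowSum, lieDerRow, List.map_cons, List.map_map,
      List.sum_cons, contract_apply, Function.comp_def]
    push_cast
    ring

lemma rowSum_wordDiffRow (F : WordCochain) (l : List BasisElt) :
    2 * wordDiff F l = rowSum F (wordDiffRow l) := by
  induction l generalizing F with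
  | nil => simp [wordDiff_nil, wordDiffRow, rowSum]
  | cons x l ih =>
    have h := ih (contract x F)
    have h' := rowSum_lieDerRow x F l
    have hneg : ∀ r : List (ℤ × List BasisElt),
        (r.map fun p => -((p.1 : ℂ) * F (x :: p.2))).sum =
          -(r.map fun p => (p.1 : ℂ) * F (x :: p.2)).sum := fun r => by
      induction r <;> simp_all [add_comm]
    simp only [rowSum] at h h'
    simp only [wordDiff_cons, mul_sub, h, h', rowSum, wordDiffRow, List.map_append, List.map_map,
      List.sum_append, contract_apply, Function.comp_def, Int.cast_neg, neg_mul, hneg]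
    ring

lemma rowSum_normalizeRow {F : WordCochain} (hF : IsSkew F) (r : List (ℤ × List BasisElt)) :
    rowSum F (normalizeRow r) = rowSum F r := by
  induction r with
  | nil => rfl
  | cons p r ih =>
    simp only [rowSum, normalizeRow, List.map_map] at ih ⊢
    by_cases h : p.1 ≠ 0 ∧ p.2.Nodup
    · rw [List.filter_cons_of_pos (by simpa using h), List.map_cons, List.map_cons,
        List.sum_cons, List.sum_cons, ih, hF.apply_signedSort p.2]
      simp only [Function.comp_apply]
      push_cast
      ring
    · rw [List.filter_cons_of_neg (by simpa using h), ih, List.map_cons, List.sum_cons]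
      by_cases h0 : p.1 = 0
      · simp [h0]
      · simp [hF.eq_zero_of_not_nodup fun hl => h ⟨h0, hl⟩]

/-- Evaluation of the differential of a skew cochain through the normalized row. -/
lemma IsSkew.wordDiff_apply {F : WordCochain} (hF : IsSkew F) {l : List BasisElt}
    {r : List (ℤ × List BasisElt)} (h : normalizeRow (wordDiffRow l) = r) :
    2 * SVCA.wordDiff F l = rowSum F r := by
  rw [rowSum_wordDiffRow, ← rowSum_normalizeRow hF, h]

/-- Twice the weight of a basis element under the grading element `(L, 1)`. -/
def weight : BasisElt → ℤ
  | (L, n) => 2 * n - 2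
  | (Y, n) => 2 * n - 1
  | (M, n) => 2 * n

/-- Twice the weight of a word. -/
def wordWeight (l : List BasisElt) : ℤ := (l.map weight).sum

lemma wordWeight_cons (x : BasisElt) (l : List BasisElt) :
    wordWeight (x :: l) = weight x + wordWeight l := by
  simp [wordWeight]

lemma weight_lieElt (x y : BasisElt) (h : lieCoef x y ≠ 0) :
    weight (lieElt x y) = weight x + weight y := by
  have h0 : 0 < x.2 + y.2 := Nat.pos_of_ne_zero fun h' => h (lieCoef_eq_zero_of_index x y h')
  obtain ⟨a, n⟩ := x
  obtain ⟨b, m⟩ := y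
  simp only at h0
  cases a <;> cases b <;> simp_all [lieElt, weight, doubledBracket, lieCoef] <;> omega

/-- Multiplication of a word cochain by a function of the weight. -/
def weightMul (φ : ℤ → ℂ) : WordCochain →ₗ[ℂ] WordCochain where
  toFun F l := φ (wordWeight l) * F l
  map_add' _ _ := funext fun _ => mul_add _ _ _
  map_smul' _ _ := funext fun _ => mul_left_comm _ _ _

lemma weightMul_apply (φ : ℤ → ℂ) (F : WordCochain) (l : List BasisElt) :
    weightMul φ F l = φ (wordWeight l) * F l := rfl

lemma contract_weightMul (φ : ℤ → ℂ) (x : BasisElt) (F : WordCochain) :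
    contract x (weightMul φ F) = weightMul (fun w => φ (weight x + w)) (contract x F) := by
  funext l
  simp [contract_apply, weightMul_apply, wordWeight_cons]

lemma lieDer_weightMul (φ : ℤ → ℂ) (x : BasisElt) (F : WordCochain) (l : List BasisElt) :
    lieDer x (weightMul φ F) l = φ (weight x + wordWeight l) * lieDer x F l := by
  induction l generalizing φ F with
  | nil => simp [lieDer_nil]
  | cons y l ih =>
    rw [lieDer_cons, lieDer_cons, contract_weightMul, ih, weightMul_apply, wordWeight_cons,
      wordWeight_cons]
    by_cases h : lieCoef x y = 0
    · simp [h, add_left_comm]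
    · rw [weight_lieElt x y h, add_left_comm (weight x), ← add_assoc (weight y),
        add_comm (weight y)]
      ring

lemma wordDiff_weightMul (φ : ℤ → ℂ) (F : WordCochain) :
    wordDiff (weightMul φ F) = weightMul φ (wordDiff F) := by
  funext l
  induction l generalizing φ F with
  | nil => simp [wordDiff_nil, weightMul_apply]
  | cons x l ih =>
    rw [wordDiff_cons, contract_weightMul, ih, lieDer_weightMul, weightMul_apply,
      weightMul_apply, wordWeight_cons, wordDiff_cons]
    ring

lemma lieDer_grading (F : WordCochain) (l : List BasisElt) :
    lieDer (L, 1) F l = (wordWeight l : ℂ) / 2 * F l := by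
  induction l generalizing F with
  | nil => simp [lieDer_nil, wordWeight]
  | cons y l ih =>
    have h1 : lieElt (L, 1) y = y := by
      obtain ⟨b, m⟩ := y
      cases b <;> simp [lieElt, doubledBracket]
    have h2 : lieCoef (L, 1) y = -weight y := by
      obtain ⟨b, m⟩ := y
      cases b <;> simp [lieCoef, doubledBracket, weight] <;> ring
    rw [lieDer_cons, ih, h1, h2, wordWeight_cons, contract_apply]
    push_cast
    ring

lemma cartan (x : BasisElt) (F : WordCochain) :
    lieDer x F = contract x (wordDiff F) + wordDiff (contract x F) := by
  rw [contract_wordDiff, sub_add_cancel]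

/-- The word cochains of degree `q` which come from polynomial cochains. -/
def wordCochains (q : ℕ) : Submodule ℂ WordCochain where
  carrier := {F | IsSkew F ∧ (∀ l, l.length ≠ q → F l = 0) ∧
    ∃ N : ℕ, ∀ l, (∃ x ∈ l, N < x.2) → F l = 0}
  add_mem' := by
    rintro F G ⟨hF, hF', N, hN⟩ ⟨hG, hG', K, hK⟩
    refine ⟨fun l₁ x y l₂ => ?_, fun l hl => ?_, max N K, fun l ⟨x, hx, h⟩ => ?_⟩
    · simp only [Pi.add_apply, hF l₁ x, hG l₁ x]
      ring
    · simp [hF' l hl, hG' l hl]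
    · simp [hN l ⟨x, hx, by omega⟩, hK l ⟨x, hx, by omega⟩]
  zero_mem' := ⟨fun _ _ _ _ => by simp, fun _ _ => rfl, 0, fun _ _ => rfl⟩
  smul_mem' := by
    rintro r F ⟨hF, hF', N, hN⟩
    refine ⟨fun l₁ x y l₂ => ?_, fun l hl => ?_, N, fun l h => ?_⟩
    · simp [hF l₁ x]
    · simp [hF' l hl]
    · simp [hN l h]

lemma contract_mem {q : ℕ} {F : WordCochain} (hF : F ∈ wordCochains (q + 1)) (x : BasisElt) :
    contract x F ∈ wordCochains q := by
  obtain ⟨h1, h2, N, h3⟩ := hF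
  refine ⟨h1.contract x, fun l hl => h2 _ (by simpa using hl), N, fun l ⟨y, hy, h⟩ => ?_⟩
  exact h3 _ ⟨y, List.mem_cons_of_mem _ hy, h⟩

lemma wordWeight_swap (l₁ : List BasisElt) (x y : BasisElt) (l₂ : List BasisElt) :
    wordWeight (l₁ ++ x :: y :: l₂) = wordWeight (l₁ ++ y :: x :: l₂) := by
  simp [wordWeight, add_left_comm]

lemma weightMul_mem {q : ℕ} {F : WordCochain} (hF : F ∈ wordCochains q) (φ : ℤ → ℂ) :
    weightMul φ F ∈ wordCochains q := by
  obtain ⟨h1, h2, N, h3⟩ := hF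
  refine ⟨fun l₁ x y l₂ => ?_, fun l hl => ?_, N, fun l h => ?_⟩
  · simp [weightMul_apply, h1 l₁ x, wordWeight_swap l₁ x]
  · simp [weightMul_apply, h2 l hl]
  · simp [weightMul_apply, h3 l h]

/-- The property of being supported on words of weight zero. -/
def IsWeightZero (F : WordCochain) : Prop := ∀ l, wordWeight l ≠ 0 → F l = 0

lemma IsWeightZero.wordDiff {F : WordCochain} (hF : IsWeightZero F) :
    IsWeightZero (wordDiff F) := by
  have h : weightMul (fun w => if w = 0 then 1 else 0) F = F := by
    funext l
    by_cases h : wordWeight l = 0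
    · simp [weightMul_apply, h]
    · simp [weightMul_apply, h, hF l h]
  intro l hl
  rw [← h, wordDiff_weightMul, weightMul_apply]
  simp [hl]

/-- Every cocycle is cohomologous to its component of weight zero. -/
lemma exists_weightZero {q : ℕ} {F : WordCochain} (hF : F ∈ wordCochains (q + 1))
    (hd : wordDiff F = 0) :
    ∃ F₀ ∈ wordCochains (q + 1), IsWeightZero F₀ ∧ wordDiff F₀ = 0 ∧
      ∃ G ∈ wordCochains q, F = F₀ + wordDiff G := by
  refine ⟨weightMul (fun w => if w = 0 then 1 else 0) F, weightMul_mem hF _, fun l hl => ?_,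
    by rw [wordDiff_weightMul, hd, map_zero],
    contract (L, 1) (weightMul (fun w => 2 * (w : ℂ)⁻¹) F), contract_mem (weightMul_mem hF _) _,
    ?_⟩
  · simp [weightMul_apply, hl]
  · have h := cartan (L, 1) (weightMul (fun w => 2 * (w : ℂ)⁻¹) F)
    rw [wordDiff_weightMul, hd, map_zero, map_zero, zero_add] at h
    rw [← h]
    funext l
    rw [Pi.add_apply, lieDer_grading, weightMul_apply, weightMul_apply]
    by_cases h0 : wordWeight l = 0
    · simp [h0]
    · have : (wordWeight l : ℂ) ≠ 0 := by exact_mod_cast h0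
      simp only [h0, if_false]
      field_simp
      ring

/-- The word cochain of degree `q` given by a function on `q`-tuples. -/
def ofTuples (q : ℕ) (f : (Fin q → BasisElt) → ℂ) : WordCochain := fun l =>
  if h : l.length = q then f fun i => l.get (i.cast h.symm) else 0

lemma ofTuples_ofFn {q : ℕ} (f : (Fin q → BasisElt) → ℂ) (p : Fin q → BasisElt) :
    ofTuples q f (List.ofFn p) = f p := by
  simp [ofTuples]

lemma ofTuples_of_ne {q : ℕ} (f : (Fin q → BasisElt) → ℂ) {l : List BasisElt}
    (h : l.length ≠ q) : ofTuples q f l = 0 := by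
  simp [ofTuples, h]

lemma exists_eq_ofFn {q : ℕ} {l : List BasisElt} (h : l.length = q) :
    ∃ p : Fin q → BasisElt, l = List.ofFn p := by
  subst h
  exact ⟨l.get, (List.ofFn_get l).symm⟩

lemma isSkew_ofTuples {q : ℕ} {f : (Fin q → BasisElt) → ℂ}
    (hf : ∀ (σ : Equiv.Perm (Fin q)) p, f (p ∘ σ) = ((Equiv.Perm.sign σ : ℤ) : ℂ) * f p) :
    IsSkew (ofTuples q f) := by
  intro l₁ x y l₂
  by_cases h : (l₁ ++ y :: x :: l₂).length = q
  · have h' : (l₁ ++ x :: y :: l₂).length = q := by simpa using h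
    have hq : l₁.length + 1 < q := by
      simp at h
      omega
    let i : Fin q := ⟨l₁.length, by omega⟩
    let j : Fin q := ⟨l₁.length + 1, hq⟩
    have hij : i ≠ j := by simp [i, j]
    have key := hf (Equiv.swap i j) fun k => (l₁ ++ y :: x :: l₂).get (k.cast h.symm)
    rw [Equiv.Perm.sign_swap hij] at key
    rw [ofTuples, dif_pos h', ofTuples, dif_pos h]
    simp only [Units.val_neg, Units.val_one, Int.cast_neg, Int.cast_one, neg_mul, one_mul] at key
    rw [← key]
    congr 1
    funext k
    simp only [Function.comp_apply, List.get_eq_getElem, Fin.val_cast]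
    by_cases hi : k = i
    · subst hi
      simp [i, j]
    · by_cases hj : k = j
      · subst hj
        simp [i, j]
      · rw [Equiv.swap_apply_of_ne_of_ne hi hj]
        have hi' : (k : ℕ) ≠ l₁.length := fun h => hi (Fin.ext h)
        have hj' : (k : ℕ) ≠ l₁.length + 1 := fun h => hj (Fin.ext h)
        rcases Nat.lt_or_ge k l₁.length with hk | hk
        · rw [List.getElem_append_left hk, List.getElem_append_left hk]
        · obtain ⟨m, hm⟩ : ∃ m, (k : ℕ) - l₁.length = m + 2 :=
            ⟨k - l₁.length - 2, by omega⟩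
          rw [List.getElem_append_right hk, List.getElem_append_right hk]
          simp [hm]
  · rw [ofTuples_of_ne _ h, ofTuples_of_ne _ (by simpa using h), neg_zero]

lemma IsSkew.apply_adjacent_swap {n : ℕ} {F : WordCochain} (hF : IsSkew F)
    (p : Fin (n + 1) → BasisElt) (i : Fin n) :
    F (List.ofFn (p ∘ Equiv.swap i.castSucc i.succ)) = -F (List.ofFn p) := by
  induction n generalizing F with
  | zero => exact i.elim0
  | succ n ih =>
    refine Fin.cases ?_ (fun i => ?_) i
    · have h1 : List.ofFn (p ∘ Equiv.swap (0 : Fin (n + 1)).castSucc (0 : Fin (n + 1)).succ) =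
          p 1 :: p 0 :: List.ofFn fun k : Fin n => p k.succ.succ := by
        rw [List.ofFn_succ, List.ofFn_succ]
        refine congrArg₂ _ (by simp) (congrArg₂ _ (by simp) (congrArg _ (funext fun k => ?_)))
        rw [Function.comp_apply, Equiv.swap_apply_of_ne_of_ne] <;> simp [Fin.ext_iff]
      have h2 : List.ofFn p = p 0 :: p 1 :: List.ofFn fun k : Fin n => p k.succ.succ := by
        rw [List.ofFn_succ, List.ofFn_succ]
        rfl
      rw [h1, h2]
      exact hF [] _ _ _
    · have h1 : List.ofFn (p ∘ Equiv.swap i.succ.castSucc i.succ.succ) =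
          p 0 :: List.ofFn ((fun k => p k.succ) ∘ Equiv.swap i.castSucc i.succ) := by
        rw [List.ofFn_succ]
        refine congrArg₂ _ ?_ (congrArg _ (funext fun k => ?_))
        · rw [Function.comp_apply, Equiv.swap_apply_of_ne_of_ne] <;> simp [Fin.ext_iff]
        · simp only [Function.comp_apply]
          rw [← Fin.succ_castSucc, (Fin.succ_injective _).swap_apply]
      rw [h1, List.ofFn_succ (f := p)]
      exact ih (hF.contract (p 0)) (fun k => p k.succ) i

lemma IsSkew.apply_perm {q : ℕ} {F : WordCochain} (hF : IsSkew F) (p : Fin q → BasisElt)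
    (σ : Equiv.Perm (Fin q)) :
    F (List.ofFn (p ∘ σ)) = ((Equiv.Perm.sign σ : ℤ) : ℂ) * F (List.ofFn p) := by
  cases q with
  | zero =>
    rw [Subsingleton.elim σ 1]
    simp
  | succ n =>
    have hσ : σ ∈ Submonoid.closure
        (Set.range fun i : Fin n => Equiv.swap i.castSucc i.succ) := by
      rw [Equiv.Perm.mclosure_swap_castSucc_succ]
      trivial
    induction hσ using Submonoid.closure_induction generalizing p with
    | mem σ h =>
      obtain ⟨i, rfl⟩ := h
      simp only
      rw [hF.apply_adjacent_swap, Equiv.Perm.sign_swap (by simp [Fin.ext_iff])]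
      simp
    | one => simp
    | mul σ τ _ _ h₁ h₂ =>
      rw [Equiv.Perm.coe_mul, ← Function.comp_assoc, h₂, h₁, Equiv.Perm.sign_mul]
      push_cast
      ring

/-- The words of weight zero with strictly increasing letters. -/
def weightZeroWords (q : ℕ) : List (List BasisElt) :=
  [(L, 0), (L, 1), (L, 2), (Y, 0), (Y, 1), (Y, 2), (M, 0), (M, 1)].sublists.filter fun l =>
    l.length = q ∧ wordWeight l = 0

lemma mem_of_weight_le (x : BasisElt) (h : weight x ≤ 3) :
    x ∈ [(L, 0), (L, 1), (L, 2), (Y, 0), (Y, 1), (Y, 2), (M, 0), (M, 1)] := by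
  obtain ⟨a, n⟩ := x
  have hn : n ≤ 2 := by cases a <;> simp [weight] at h <;> omega
  interval_cases n <;> cases a <;> simp_all [weight]

lemma weight_le_of_mem {s : Finset BasisElt} (hs : ∑ x ∈ s, weight x = 0) {x : BasisElt}
    (hx : x ∈ s) : weight x ≤ 3 := by
  by_contra! h
  have h1 : ∑ y ∈ s.erase x, weight y = -weight x := by
    rw [← Finset.add_sum_erase s _ hx] at hs
    omega
  have h2 : ∑ y ∈ s.erase x, min (weight y) 0 ≤ ∑ y ∈ s.erase x, weight y :=
    Finset.sum_le_sum fun y _ => min_le_left _ _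
  have h3 : ∑ y ∈ s.erase x, -min (weight y) 0 ≤
      ∑ y ∈ ({(L, 0), (Y, 0)} : Finset BasisElt), -min (weight y) 0 := by
    rw [← Finset.sum_filter_ne_zero]
    refine Finset.sum_le_sum_of_subset_of_nonneg (fun y hy => ?_) fun y _ _ => by omega
    obtain ⟨a, n⟩ := y
    rw [Finset.mem_filter] at hy
    rcases n with _ | n <;> cases a <;> simp_all [weight] <;> omega
  have h4 : ∑ y ∈ ({(L, 0), (Y, 0)} : Finset BasisElt), -min (weight y) 0 = 3 := by decide
  rw [Finset.sum_neg_distrib] at h3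
  omega

/-- A skew cochain of weight zero is determined by its values on finitely many words. -/
lemma eq_zero_of_weightZeroWords {q : ℕ} {F : WordCochain} (hF : F ∈ wordCochains q)
    (h0 : IsWeightZero F) (h : ∀ l ∈ weightZeroWords q, F l = 0) : F = 0 := by
  funext l
  by_contra hl
  have hq : l.length = q := by
    by_contra hq
    exact hl (hF.2.1 l hq)
  have hw : wordWeight l = 0 := by
    by_contra hw
    exact hl (h0 l hw)
  have hnd : l.Nodup := by
    by_contra hnd
    exact hl (hF.1.eq_zero_of_not_nodup hnd)
  have hsum : ∑ x ∈ l.toFinset, weight x = 0 := by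
    rw [List.sum_toFinset _ hnd]
    exact hw
  set U : List BasisElt :=
    [(L, 0), (L, 1), (L, 2), (Y, 0), (Y, 1), (Y, 2), (M, 0), (M, 1)] with hU
  have hUnd : U.Nodup := by decide
  have hperm : (U.filter fun x => x ∈ l).Perm l := by
    rw [List.perm_ext_iff_of_nodup (hUnd.filter _) hnd]
    intro x
    simp only [List.mem_filter, decide_eq_true_eq, and_iff_right_iff_imp]
    intro hx
    exact mem_of_weight_le x (weight_le_of_mem hsum (List.mem_toFinset.mpr hx))
  refine hl (IsSkew.eq_zero_of_perm hperm hF.1 (h _ ?_))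
  simp only [weightZeroWords, List.mem_filter, List.mem_sublists, decide_eq_true_eq]
  exact ⟨List.filter_sublist, hperm.length_eq.trans hq, by
    rw [wordWeight, (hperm.map weight).sum_eq]
    exact hw⟩

/-- There are skew cochains of weight zero with arbitrary values on the increasing words. -/
lemma exists_prescribed (q : ℕ) (v : WordCochain) :
    ∃ G ∈ wordCochains q, IsWeightZero G ∧ ∀ l ∈ weightZeroWords q, G l = v l := by
  classical
  let e : List BasisElt → WordCochain := fun s => ofTuples q fun p =>
    (Matrix.of fun i j : Fin q => if s[(j : ℕ)]? = some (p i) then (1 : ℂ) else 0).det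
  have hskew : ∀ s, IsSkew (e s) := fun s => isSkew_ofTuples fun σ p =>
    Matrix.det_permute σ
      (Matrix.of fun i j : Fin q => if s[(j : ℕ)]? = some (p i) then (1 : ℂ) else 0)
  have hmem : ∀ s l, e s l ≠ 0 → l.length = q ∧ ∀ x ∈ l, x ∈ s := by
    intro s l h
    have hq : l.length = q := by
      by_contra hq
      exact h (ofTuples_of_ne _ hq)
    refine ⟨hq, fun x hx => ?_⟩
    obtain ⟨p, rfl⟩ := exists_eq_ofFn hq
    obtain ⟨i, rfl⟩ := (List.mem_ofFn' p x).mp hx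
    by_contra hi
    refine h ((ofTuples_ofFn _ p).trans (Matrix.det_eq_zero_of_row_eq_zero i fun j => ?_))
    simp only [Matrix.of_apply, ite_eq_right_iff, one_ne_zero, imp_false]
    exact fun h => hi (List.mem_of_getElem? h)
  have hone : ∀ s ∈ weightZeroWords q, e s s = 1 := by
    intro s hs
    simp only [weightZeroWords, List.mem_filter, List.mem_sublists, decide_eq_true_eq] at hs
    have hnd : s.Nodup := hs.1.nodup (by decide)
    obtain ⟨p, rfl⟩ := exists_eq_ofFn hs.2.1
    rw [List.nodup_ofFn] at hnd
    refine (ofTuples_ofFn _ p).trans ((congrArg Matrix.det ?_).trans Matrix.det_one)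
    ext i j
    simp [Matrix.one_apply, hnd.eq_iff, eq_comm]
  have hne : ∀ s ∈ weightZeroWords q, ∀ t ∈ weightZeroWords q, s ≠ t → e s t = 0 := by
    intro s hs t ht hst
    by_contra h
    obtain ⟨-, h⟩ := hmem s t h
    simp only [weightZeroWords, List.mem_filter, List.mem_sublists, decide_eq_true_eq] at hs ht
    refine hst ?_
    have hp : t.Perm s := by
      refine (List.subperm_of_subset (ht.1.nodup (by decide)) h).perm_of_length_le ?_
      rw [hs.2.1, ht.2.1]
    have hsorted : ([(L, 0), (L, 1), (L, 2), (Y, 0), (Y, 1), (Y, 2), (M, 0), (M, 1)] :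
      List BasisElt).Pairwise fun x y => sortKey x < sortKey y := by decide
    exact (hp.eq_of_pairwise (le := fun x y => sortKey x < sortKey y)
      (fun a b _ _ h1 h2 => absurd h1 (by omega))
      (hsorted.sublist ht.1) (hsorted.sublist hs.1)).symm
  refine ⟨∑ s ∈ (weightZeroWords q).toFinset, v s • weightMul (fun w => if w = 0 then 1 else 0)
      (e s), ?_, fun l hl => ?_, fun l hl => ?_⟩
  · refine Submodule.sum_mem _ fun s _ => Submodule.smul_mem _ _ (weightMul_mem
      ⟨hskew s, fun l hl => ofTuples_of_ne _ hl, (s.map Prod.snd).sum, fun l ⟨x, hx, h⟩ => ?_⟩ _)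
    by_contra h'
    have := List.single_le_sum (fun _ _ => Nat.zero_le _) _
      (List.mem_map_of_mem (f := Prod.snd) ((hmem s l h').2 x hx))
    omega
  · simp [Finset.sum_apply, weightMul_apply, hl]
  · have hw : wordWeight l = 0 := by
      simp only [weightZeroWords, List.mem_filter, decide_eq_true_eq] at hl
      exact hl.2.2
    rw [Finset.sum_apply, Finset.sum_eq_single l]
    · simp [weightMul_apply, hw, hone l hl]
    · intro s hs hsl
      simp [weightMul_apply, hne s (List.mem_toFinset.mp hs) l hl hsl]
    · intro h
      exact absurd (List.mem_toFinset.mpr hl) h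

lemma IsSkew.wordDiff_two {F : WordCochain} (hF : IsSkew F) :
    wordDiff F [(L, 0), (L, 2)] = 2 * F [(L, 1)] ∧
    wordDiff F [(L, 0), (M, 1)] = F [(M, 0)] ∧
    wordDiff F [(L, 1), (M, 0)] = 0 ∧
    wordDiff F [(Y, 0), (Y, 1)] = F [(M, 0)] := by
  have h₁ := hF.wordDiff_apply (l := [(L, 0), (L, 2)]) rfl
  have h₂ := hF.wordDiff_apply (l := [(L, 0), (M, 1)]) rfl
  have h₃ := hF.wordDiff_apply (l := [(L, 1), (M, 0)]) rfl
  have h₄ := hF.wordDiff_apply (l := [(Y, 0), (Y, 1)]) rfl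
  simp [rowSum, normalizeRow, wordDiffRow, lieDerRow, lieCoef, lieElt, doubledBracket,
    signedSort, signedInsert] at h₁ h₂ h₃ h₄
  refine ⟨?_, ?_, ?_, ?_⟩
  · linear_combination h₁ / 2
  · linear_combination h₂
  · linear_combination h₃
  · linear_combination h₄

lemma IsSkew.wordDiff_three {F : WordCochain} (hF : IsSkew F) :
    wordDiff F [(L, 0), (L, 1), (L, 2)] = 0 ∧
    wordDiff F [(L, 0), (L, 1), (M, 1)] = F [(L, 1), (M, 0)] ∧
    wordDiff F [(L, 0), (L, 2), (M, 0)] = 2 * F [(L, 1), (M, 0)] ∧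
    wordDiff F [(L, 0), (Y, 0), (Y, 2)] =
      2 * F [(Y, 0), (Y, 1)] - 2 * F [(L, 0), (M, 1)] ∧
    wordDiff F [(L, 0), (M, 0), (M, 1)] = 0 ∧
    wordDiff F [(L, 1), (Y, 0), (Y, 1)] = -F [(L, 1), (M, 0)] ∧
    wordDiff F [(Y, 0), (Y, 1), (M, 0)] = 0 := by
  have h₁ := hF.wordDiff_apply (l := [(L, 0), (L, 1), (L, 2)]) rfl
  have h₂ := hF.wordDiff_apply (l := [(L, 0), (L, 1), (M, 1)]) rfl
  have h₃ := hF.wordDiff_apply (l := [(L, 0), (L, 2), (M, 0)]) rfl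
  have h₄ := hF.wordDiff_apply (l := [(L, 0), (Y, 0), (Y, 2)]) rfl
  have h₅ := hF.wordDiff_apply (l := [(L, 0), (M, 0), (M, 1)]) rfl
  have h₆ := hF.wordDiff_apply (l := [(L, 1), (Y, 0), (Y, 1)]) rfl
  have h₇ := hF.wordDiff_apply (l := [(Y, 0), (Y, 1), (M, 0)]) rfl
  simp [rowSum, normalizeRow, wordDiffRow, lieDerRow, lieCoef, lieElt, doubledBracket,
    signedSort, signedInsert, sortKey] at h₁ h₂ h₃ h₄ h₅ h₆ h₇
  refine ⟨?_, ?_, ?_, ?_, ?_, ?_, ?_⟩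
  · linear_combination h₁
  · linear_combination h₂
  · linear_combination h₃ / 2
  · linear_combination h₄ / 2
  · linear_combination h₅
  · linear_combination h₆ / 2
  · linear_combination h₇

lemma IsSkew.wordDiff_four {F : WordCochain} (hF : IsSkew F) :
    wordDiff F [(L, 0), (L, 1), (L, 2), (M, 0)] = 0 ∧
    wordDiff F [(L, 0), (L, 1), (Y, 0), (Y, 2)] =
      2 * F [(L, 1), (Y, 0), (Y, 1)] + 2 * F [(L, 0), (L, 1), (M, 1)] ∧
    wordDiff F [(L, 0), (L, 1), (M, 0), (M, 1)] = 0 ∧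
    wordDiff F [(L, 0), (L, 2), (Y, 0), (Y, 1)] =
      2 * F [(L, 1), (Y, 0), (Y, 1)] + F [(L, 0), (L, 2), (M, 0)] ∧
    wordDiff F [(L, 0), (Y, 0), (Y, 1), (M, 1)] =
      F [(Y, 0), (Y, 1), (M, 0)] - F [(L, 0), (M, 0), (M, 1)] ∧
    wordDiff F [(L, 0), (Y, 0), (Y, 2), (M, 0)] =
      2 * F [(Y, 0), (Y, 1), (M, 0)] + 2 * F [(L, 0), (M, 0), (M, 1)] ∧
    wordDiff F [(L, 1), (Y, 0), (Y, 1), (M, 0)] = 0 := by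
  have h₁ := hF.wordDiff_apply (l := [(L, 0), (L, 1), (L, 2), (M, 0)]) rfl
  have h₂ := hF.wordDiff_apply (l := [(L, 0), (L, 1), (Y, 0), (Y, 2)]) rfl
  have h₃ := hF.wordDiff_apply (l := [(L, 0), (L, 1), (M, 0), (M, 1)]) rfl
  have h₄ := hF.wordDiff_apply (l := [(L, 0), (L, 2), (Y, 0), (Y, 1)]) rfl
  have h₅ := hF.wordDiff_apply (l := [(L, 0), (Y, 0), (Y, 1), (M, 1)]) rfl
  have h₆ := hF.wordDiff_apply (l := [(L, 0), (Y, 0), (Y, 2), (M, 0)]) rfl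
  have h₇ := hF.wordDiff_apply (l := [(L, 1), (Y, 0), (Y, 1), (M, 0)]) rfl
  simp [rowSum, normalizeRow, wordDiffRow, lieDerRow, lieCoef, lieElt, doubledBracket,
    signedSort, signedInsert, sortKey] at h₁ h₂ h₃ h₄ h₅ h₆ h₇
  refine ⟨?_, ?_, ?_, ?_, ?_, ?_, ?_⟩
  · linear_combination h₁
  · linear_combination h₂ / 2
  · linear_combination h₃
  · linear_combination h₄ / 2
  · linear_combination h₅ / 2
  · linear_combination h₆ / 2
  · linear_combination h₇

lemma IsSkew.wordDiff_five {F : WordCochain} (hF : IsSkew F) :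
    wordDiff F [(L, 0), (L, 1), (L, 2), (Y, 0), (Y, 1)] =
      -F [(L, 0), (L, 1), (L, 2), (M, 0)] ∧
    wordDiff F [(L, 0), (L, 1), (Y, 0), (Y, 1), (M, 1)] =
      F [(L, 1), (Y, 0), (Y, 1), (M, 0)] + F [(L, 0), (L, 1), (M, 0), (M, 1)] ∧
    wordDiff F [(L, 0), (L, 1), (Y, 0), (Y, 2), (M, 0)] =
      2 * F [(L, 1), (Y, 0), (Y, 1), (M, 0)] - 2 * F [(L, 0), (L, 1), (M, 0), (M, 1)] ∧
    wordDiff F [(L, 0), (L, 2), (Y, 0), (Y, 1), (M, 0)] =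
      2 * F [(L, 1), (Y, 0), (Y, 1), (M, 0)] ∧
    wordDiff F [(L, 0), (Y, 0), (Y, 1), (M, 0), (M, 1)] = 0 := by
  have h₁ := hF.wordDiff_apply (l := [(L, 0), (L, 1), (L, 2), (Y, 0), (Y, 1)]) rfl
  have h₂ := hF.wordDiff_apply (l := [(L, 0), (L, 1), (Y, 0), (Y, 1), (M, 1)]) rfl
  have h₃ := hF.wordDiff_apply (l := [(L, 0), (L, 1), (Y, 0), (Y, 2), (M, 0)]) rfl
  have h₄ := hF.wordDiff_apply (l := [(L, 0), (L, 2), (Y, 0), (Y, 1), (M, 0)]) rfl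
  have h₅ := hF.wordDiff_apply (l := [(L, 0), (Y, 0), (Y, 1), (M, 0), (M, 1)]) rfl
  simp [rowSum, normalizeRow, wordDiffRow, lieDerRow, lieCoef, lieElt, doubledBracket,
    signedSort, signedInsert, sortKey] at h₁ h₂ h₃ h₄ h₅
  refine ⟨?_, ?_, ?_, ?_, ?_⟩
  · linear_combination h₁ / 2
  · linear_combination h₂ / 2
  · linear_combination h₃ / 2
  · linear_combination h₄ / 2
  · linear_combination h₅

lemma IsSkew.wordDiff_six {F : WordCochain} (hF : IsSkew F) :
    wordDiff F [(L, 0), (L, 1), (L, 2), (Y, 0), (Y, 1), (M, 0)] = 0 ∧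
    wordDiff F [(L, 0), (L, 1), (Y, 0), (Y, 1), (M, 0), (M, 1)] = 0 := by
  have h₁ := hF.wordDiff_apply (l := [(L, 0), (L, 1), (L, 2), (Y, 0), (Y, 1), (M, 0)]) rfl
  have h₂ := hF.wordDiff_apply (l := [(L, 0), (L, 1), (Y, 0), (Y, 1), (M, 0), (M, 1)]) rfl
  simp [rowSum, normalizeRow, wordDiffRow, lieDerRow, lieCoef, lieElt, doubledBracket,
    signedSort, signedInsert, sortKey] at h₁ h₂
  refine ⟨?_, ?_⟩
  · linear_combination h₁
  · linear_combination h₂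

lemma lieDer_eq_zero_of_length {F : WordCochain} {l : List BasisElt} (x : BasisElt)
    (h : ∀ l', l'.length = l.length → F l' = 0) : lieDer x F l = 0 := by
  induction l generalizing F with
  | nil => rfl
  | cons y l ih =>
    rw [lieDer_cons, h (lieElt x y :: l) rfl, mul_zero, zero_add]
    exact ih fun l' hl' => h (y :: l') (by simp [hl'])

lemma wordDiff_eq_zero_of_length {F : WordCochain} {l : List BasisElt}
    (h : ∀ l', l'.length + 1 = l.length → F l' = 0) : wordDiff F l = 0 := by
  induction l generalizing F with
  | nil => rfl
  | cons y l ih =>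
    rw [wordDiff_cons, lieDer_eq_zero_of_length y fun l' hl' => h l' (by simp [hl']), ih,
      sub_zero]
    exact fun l' hl' => h (y :: l') (by simp [hl'])

lemma contract_eq_zero_of_index {F : WordCochain} {N : ℕ}
    (hN : ∀ l, (∃ x ∈ l, N < x.2) → F l = 0) {x : BasisElt} (hx : N < x.2) :
    contract x F = 0 :=
  funext fun _ => hN _ ⟨x, List.mem_cons_self, hx⟩

lemma lieDer_eq_zero_of_index {F : WordCochain} {N : ℕ}
    (hN : ∀ l, (∃ x ∈ l, N < x.2) → F l = 0) {x : BasisElt} {l : List BasisElt}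
    (hl : ∃ y ∈ x :: l, N + 1 < y.2) : lieDer x F l = 0 := by
  induction l generalizing F with
  | nil => rfl
  | cons y l ih =>
    have h1 : F (lieElt x y :: l) = 0 := by
      refine hN _ ?_
      obtain ⟨z, hz, h⟩ := hl
      simp only [List.mem_cons] at hz
      rcases hz with rfl | rfl | hz
      · exact ⟨_, List.mem_cons_self, by simp only [lieElt]; omega⟩
      · exact ⟨_, List.mem_cons_self, by simp only [lieElt]; omega⟩
      · exact ⟨z, List.mem_cons_of_mem _ hz, by omega⟩
    rw [lieDer_cons, h1, mul_zero, zero_add]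
    by_cases hy : N < y.2
    · simp [contract_eq_zero_of_index hN hy]
    · refine ih (fun l' ⟨z, hz, h⟩ => hN _ ⟨z, List.mem_cons_of_mem _ hz, h⟩) ?_
      obtain ⟨z, hz, h⟩ := hl
      simp only [List.mem_cons] at hz ⊢
      rcases hz with rfl | rfl | hz
      · exact ⟨_, Or.inl rfl, h⟩
      · omega
      · exact ⟨z, Or.inr hz, h⟩

lemma wordDiff_eq_zero_of_index {F : WordCochain} {N : ℕ}
    (hN : ∀ l, (∃ x ∈ l, N < x.2) → F l = 0) {l : List BasisElt}
    (hl : ∃ y ∈ l, N + 1 < y.2) : wordDiff F l = 0 := by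
  induction l generalizing F with
  | nil => rfl
  | cons y l ih =>
    rw [wordDiff_cons, lieDer_eq_zero_of_index hN hl, zero_sub, neg_eq_zero]
    by_cases hy : N < y.2
    · simp [contract_eq_zero_of_index hN hy]
    · refine ih (fun l' ⟨z, hz, h⟩ => hN _ ⟨z, List.mem_cons_of_mem _ hz, h⟩) ?_
      obtain ⟨z, hz, h⟩ := hl
      rcases List.mem_cons.mp hz with rfl | hz
      · omega
      · exact ⟨z, hz, h⟩

lemma lieDer_mem {q : ℕ} {F : WordCochain} (hF : F ∈ wordCochains q) (x : BasisElt) :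
    lieDer x F ∈ wordCochains q := by
  obtain ⟨h1, h2, N, h3⟩ := hF
  exact ⟨h1.lieDer x, fun l hl => lieDer_eq_zero_of_length x fun l' hl' => h2 l' (hl' ▸ hl),
    N + 1, fun l ⟨y, hy, h⟩ => lieDer_eq_zero_of_index h3 ⟨y, List.mem_cons_of_mem _ hy, h⟩⟩

lemma wordDiff_mem {q : ℕ} {F : WordCochain} (hF : F ∈ wordCochains q) :
    wordDiff F ∈ wordCochains (q + 1) := by
  obtain ⟨h1, h2, N, h3⟩ := hF
  exact ⟨h1.wordDiff, fun l hl => wordDiff_eq_zero_of_length fun l' hl' => h2 l' (by omega),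
    N + 1, fun l h => wordDiff_eq_zero_of_index h3 h⟩

/-- The operator corresponding to `∂` is injective in positive degrees. -/
lemma eq_zero_of_lieDer_eq_zero {q : ℕ} {F : WordCochain} (hF : F ∈ wordCochains (q + 1))
    (h : lieDer (L, 0) F = 0) : F = 0 := by
  obtain ⟨-, h2, N, h3⟩ := hF
  have key : ∀ (a : SVGen) (k n : ℕ), N < n + k → contract (a, n) F = 0 := by
    intro a k
    induction k with
    | zero => exact fun n hn => contract_eq_zero_of_index h3 hn
    | succ k ih =>
      intro n hn
      funext l
      have h' := congrFun h ((a, n + 1) :: l)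
      have e1 : lieElt (L, 0) (a, n + 1) = (a, n) := by
        cases a <;> simp [lieElt, doubledBracket]
      have e2 : lieCoef (L, 0) (a, n + 1) = -2 * (n + 1) := by
        cases a <;> simp [lieCoef, doubledBracket]
      rw [lieDer_cons, ih (n + 1) (by omega), map_zero, e1, e2] at h'
      have hn : (n : ℂ) + 1 ≠ 0 := Nat.cast_add_one_ne_zero n
      simpa [hn, contract_apply] using h'
  funext l
  cases l with
  | nil => exact h2 _ (by simp)
  | cons x l => exact congrFun (key x.1 (N + 1) x.2 (by omega)) l

/-- A family of cocycles of degree `q + 1` representing a basis of the basic cohomology. -/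
structure IsBasicBasis (q : ℕ) {ι : Type*} [Fintype ι] (e : ι → WordCochain) : Prop where
  mem : ∀ i, e i ∈ wordCochains (q + 1)
  closed : ∀ i, wordDiff (e i) = 0
  indep : ∀ c : ι → ℂ, ∀ G ∈ wordCochains q, ∑ i, c i • e i = wordDiff G → c = 0
  span : ∀ F ∈ wordCochains (q + 1), wordDiff F = 0 →
    ∃ c : ι → ℂ, ∃ G ∈ wordCochains q, F = ∑ i, c i • e i + wordDiff G

/-- To span the basic cohomology it is enough to solve the linear equations on the words of
weight zero. -/
lemma span_of_weightZeroWords {q : ℕ} {ι : Type*} [Fintype ι] {e : ι → WordCochain}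
    (he : ∀ i, e i ∈ wordCochains (q + 1)) (he₀ : ∀ i, IsWeightZero (e i))
    (h : ∀ F ∈ wordCochains (q + 1), wordDiff F = 0 → ∃ (c : ι → ℂ) (v : WordCochain),
      ∀ G ∈ wordCochains q, (∀ l ∈ weightZeroWords q, G l = v l) →
        ∀ l ∈ weightZeroWords (q + 1), F l = (∑ i, c i * e i l) + wordDiff G l)
    {F : WordCochain} (hF : F ∈ wordCochains (q + 1)) (hd : wordDiff F = 0) :
    ∃ c : ι → ℂ, ∃ G ∈ wordCochains q, F = ∑ i, c i • e i + wordDiff G := by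
  obtain ⟨F₀, hF₀, hz, hd₀, G, hG, rfl⟩ := exists_weightZero hF hd
  obtain ⟨c, v, hv⟩ := h F₀ hF₀ hd₀
  obtain ⟨G', hG', hz', hv'⟩ := exists_prescribed q v
  refine ⟨c, G' + G, Submodule.add_mem _ hG' hG, ?_⟩
  rw [map_add, ← add_assoc, add_left_inj, ← sub_eq_zero]
  refine eq_zero_of_weightZeroWords (Submodule.sub_mem _ hF₀ (Submodule.add_mem _
    (Submodule.sum_mem _ fun i _ => Submodule.smul_mem _ _ (he i)) (wordDiff_mem hG'))) ?_ ?_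
  · intro l hl
    simp [Finset.sum_apply, hz l hl, he₀ _ l hl, hz'.wordDiff l hl]
  · intro l hl
    simp [Finset.sum_apply, hv G' hG' hv' l hl]

lemma weightZeroWords_1 : (weightZeroWords 1).Perm [[(L, 1)],
    [(M, 0)]] := by decide +kernel

lemma weightZeroWords_2 : (weightZeroWords 2).Perm [[(L, 0), (L, 2)],
    [(L, 0), (M, 1)],
    [(L, 1), (M, 0)],
    [(Y, 0), (Y, 1)]] := by decide +kernel

lemma weightZeroWords_3 : (weightZeroWords 3).Perm [[(L, 0), (L, 1), (L, 2)],
    [(L, 0), (L, 1), (M, 1)],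
    [(L, 0), (L, 2), (M, 0)],
    [(L, 0), (Y, 0), (Y, 2)],
    [(L, 0), (M, 0), (M, 1)],
    [(L, 1), (Y, 0), (Y, 1)],
    [(Y, 0), (Y, 1), (M, 0)]] := by decide +kernel

lemma weightZeroWords_4 : (weightZeroWords 4).Perm [[(L, 0), (L, 1), (L, 2), (M, 0)],
    [(L, 0), (L, 1), (Y, 0), (Y, 2)],
    [(L, 0), (L, 1), (M, 0), (M, 1)],
    [(L, 0), (L, 2), (Y, 0), (Y, 1)],
    [(L, 0), (Y, 0), (Y, 1), (M, 1)],
    [(L, 0), (Y, 0), (Y, 2), (M, 0)],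
    [(L, 1), (Y, 0), (Y, 1), (M, 0)]] := by decide +kernel

lemma weightZeroWords_5 : (weightZeroWords 5).Perm [[(L, 0), (L, 1), (L, 2), (Y, 0), (Y, 1)],
    [(L, 0), (L, 1), (Y, 0), (Y, 1), (M, 1)],
    [(L, 0), (L, 1), (Y, 0), (Y, 2), (M, 0)],
    [(L, 0), (L, 2), (Y, 0), (Y, 1), (M, 0)],
    [(L, 0), (Y, 0), (Y, 1), (M, 0), (M, 1)]] := by decide +kernel

lemma weightZeroWords_6 : (weightZeroWords 6).Perm [
    [(L, 0), (L, 1), (L, 2), (Y, 0), (Y, 1), (M, 0)],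
    [(L, 0), (L, 1), (Y, 0), (Y, 1), (M, 0), (M, 1)]] := by decide +kernel

lemma weightZeroWords_eq_nil {q : ℕ} (hq : 7 ≤ q) : weightZeroWords q = [] := by
  have h : ∀ l ∈ [(L, 0), (L, 1), (L, 2), (Y, 0), (Y, 1), (Y, 2), (M, 0), (M, 1)].sublists,
      wordWeight l = 0 → l.length ≤ 6 := by decide +kernel
  rw [weightZeroWords, List.filter_eq_nil_iff]
  intro l hl hl'
  simp only [decide_eq_true_eq] at hl'
  have := h l hl hl'.2
  omega

lemma wordDiff_eq_zero_of_isWeightZero_five {F : WordCochain} (hF : F ∈ wordCochains 5)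
    (h : IsWeightZero F) : wordDiff F = 0 := by
  refine eq_zero_of_weightZeroWords (wordDiff_mem hF) h.wordDiff ?_
  simp only [weightZeroWords_6.mem_iff, List.forall_mem_cons]
  simp [hF.1.wordDiff_six]

lemma wordDiff_eq_zero_of_isWeightZero {q : ℕ} (hq : 6 ≤ q) {F : WordCochain}
    (hF : F ∈ wordCochains q) (h : IsWeightZero F) : wordDiff F = 0 := by
  refine eq_zero_of_weightZeroWords (wordDiff_mem hF) h.wordDiff fun l hl => ?_
  simp [weightZeroWords_eq_nil (show 7 ≤ q + 1 by omega)] at hl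

lemma isBasicBasis_one : IsBasicBasis 0 (![] : Fin 0 → WordCochain) where
  mem i := i.elim0
  closed i := i.elim0
  indep c _ _ _ := Subsingleton.elim c 0
  span F hF hd := by
    refine span_of_weightZeroWords (fun i => i.elim0) (fun i => i.elim0) ?_ hF hd
    intro F hF hd
    refine ⟨0, 0, fun G hG hv l hl => ?_⟩
    rw [weightZeroWords_1.mem_iff] at hl
    obtain ⟨r₁, r₂, -⟩ := hF.1.wordDiff_two
    simp only [hd, Pi.zero_apply] at r₁ r₂
    simp only [List.mem_cons, List.not_mem_nil, or_false] at hl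
    rcases hl with rfl | rfl
    · simp only [Finset.univ_eq_empty, Finset.sum_empty, wordDiff_cons, lieDer_nil, wordDiff_nil]
      linear_combination -r₁ / 2
    · simp only [Finset.univ_eq_empty, Finset.sum_empty, wordDiff_cons, lieDer_nil, wordDiff_nil]
      linear_combination -r₂

lemma isBasicBasis_two : IsBasicBasis 1 (![] : Fin 0 → WordCochain) where
  mem i := i.elim0
  closed i := i.elim0
  indep c _ _ _ := Subsingleton.elim c 0
  span F hF hd := by
    refine span_of_weightZeroWords (fun i => i.elim0) (fun i => i.elim0) ?_ hF hd
    intro F hF hd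
    refine ⟨0, fun l => if l = [(L, 1)] then F [(L, 0), (L, 2)] / 2 else
      if l = [(M, 0)] then F [(L, 0), (M, 1)] else 0,
      fun G hG hv => ?_⟩
    simp only [weightZeroWords_1.mem_iff, weightZeroWords_2.mem_iff, List.forall_mem_cons] at hv ⊢
    simp at hv ⊢
    obtain ⟨-, r₁, -, r₂, -⟩ := hF.1.wordDiff_three
    obtain ⟨s₁, s₂, s₃, s₄⟩ := hG.1.wordDiff_two
    simp only [hd, Pi.zero_apply] at r₁ r₂
    rw [s₁, s₂, s₃, s₄, hv.1, hv.2]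
    refine ⟨?_, ?_, ?_, ?_⟩
    · ring
    · ring
    · linear_combination -r₁
    · linear_combination -r₂ / 2

lemma isBasicBasis_three {Φ : WordCochain} (hΦ : Φ ∈ wordCochains 3) (hΦ₀ : IsWeightZero Φ)
    (hd : wordDiff Φ = 0) (h : Φ [(L, 0), (L, 1), (L, 2)] ≠ 0) : IsBasicBasis 2 ![Φ] where
  mem := by simpa using hΦ
  closed := by simpa using hd
  indep c G hG h' := by
    have h₁ := congrFun h' [(L, 0), (L, 1), (L, 2)]
    rw [hG.1.wordDiff_three.1] at h₁
    funext i
    simpa [h, Subsingleton.elim i 0] using h₁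
  span F hF hF' := by
    refine span_of_weightZeroWords (by simpa using hΦ) (by simpa using hΦ₀) ?_ hF hF'
    intro F hF hF'
    set c := F [(L, 0), (L, 1), (L, 2)] / Φ [(L, 0), (L, 1), (L, 2)] with hc
    obtain ⟨K, hK⟩ : ∃ K, K = F - c • Φ := ⟨_, rfl⟩
    have hKm : K ∈ wordCochains 3 :=
      hK ▸ Submodule.sub_mem _ hF (Submodule.smul_mem _ _ hΦ)
    have hKd : wordDiff K = 0 := by
      rw [hK, map_sub, map_smul, hF', hd, smul_zero, sub_zero]
    have hFK : ∀ l, F l = c * Φ l + K l := fun l => by simp [hK]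
    have hK₁ : K [(L, 0), (L, 1), (L, 2)] = 0 := by simp [hK, hc, h]
    refine ⟨![c], fun l => if l = [(L, 1), (M, 0)] then K [(L, 0), (L, 1), (M, 1)] else
      if l = [(Y, 0), (Y, 1)] then K [(L, 0), (Y, 0), (Y, 2)] / 2 else 0, fun G hG hv => ?_⟩
    simp only [weightZeroWords_2.mem_iff, weightZeroWords_3.mem_iff, List.forall_mem_cons]
      at hv ⊢
    simp at hv ⊢
    obtain ⟨-, v₂, v₃, v₄⟩ := hv
    obtain ⟨-, r₁, -, r₂, r₃, r₄, -⟩ := hKm.1.wordDiff_four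
    obtain ⟨s₁, s₂, s₃, s₄, s₅, s₆, s₇⟩ := hG.1.wordDiff_three
    simp only [hKd, Pi.zero_apply] at r₁ r₂ r₃ r₄
    simp only [hFK, add_right_inj, s₁, s₂, s₃, s₄, s₅, s₆, s₇, v₂, v₃, v₄]
    refine ⟨hK₁, trivial, ?_, ?_, ?_, ?_, ?_⟩
    · linear_combination -r₂ + r₁
    · ring
    · linear_combination -r₄ / 4 + r₃ / 2
    · linear_combination -r₁ / 2
    · linear_combination -r₄ / 4 - r₃ / 2

lemma isBasicBasis_four : IsBasicBasis 3 (![] : Fin 0 → WordCochain) where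
  mem i := i.elim0
  closed i := i.elim0
  indep c _ _ _ := Subsingleton.elim c 0
  span F hF hd := by
    refine span_of_weightZeroWords (fun i => i.elim0) (fun i => i.elim0) ?_ hF hd
    intro F hF hd
    refine ⟨0, fun l =>
      if l = [(L, 0), (L, 1), (M, 1)] then F [(L, 0), (L, 1), (Y, 0), (Y, 2)] / 2 else
      if l = [(L, 0), (L, 2), (M, 0)] then F [(L, 0), (L, 2), (Y, 0), (Y, 1)] else
      if l = [(Y, 0), (Y, 1), (M, 0)] then
        F [(L, 0), (Y, 0), (Y, 1), (M, 1)] / 2 + F [(L, 0), (Y, 0), (Y, 2), (M, 0)] / 4 else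
      if l = [(L, 0), (M, 0), (M, 1)] then
        F [(L, 0), (Y, 0), (Y, 2), (M, 0)] / 4 - F [(L, 0), (Y, 0), (Y, 1), (M, 1)] / 2 else 0,
      fun G hG hv => ?_⟩
    simp only [weightZeroWords_3.mem_iff, weightZeroWords_4.mem_iff, List.forall_mem_cons] at hv ⊢
    simp at hv ⊢
    obtain ⟨-, v₂, v₃, -, v₅, v₆, v₇⟩ := hv
    obtain ⟨r₁, r₂, r₃, r₄, -⟩ := hF.1.wordDiff_five
    obtain ⟨s₁, s₂, s₃, s₄, s₅, s₆, s₇⟩ := hG.1.wordDiff_four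
    simp only [hd, Pi.zero_apply] at r₁ r₂ r₃ r₄
    simp only [s₁, s₂, s₃, s₄, s₅, s₆, s₇, v₂, v₃, v₅, v₆, v₇]
    refine ⟨?_, ?_, ?_, ?_, ?_, ?_, ?_⟩
    · linear_combination r₁
    · ring
    · linear_combination r₃ / 2 - r₄ / 2
    · ring
    · ring
    · ring
    · linear_combination -r₄ / 2

lemma isBasicBasis_five {Λ Ψ : WordCochain} (hΛ : Λ ∈ wordCochains 5) (hΛ₀ : IsWeightZero Λ)
    (hΨ : Ψ ∈ wordCochains 5) (hΨ₀ : IsWeightZero Ψ)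
    (hΛ₁ : Λ [(L, 0), (L, 1), (Y, 0), (Y, 1), (M, 1)] = 1)
    (hΛ₂ : Λ [(L, 0), (L, 1), (Y, 0), (Y, 2), (M, 0)] = 0)
    (hΛ₃ : Λ [(L, 0), (L, 2), (Y, 0), (Y, 1), (M, 0)] = 0)
    (hΛ₄ : Λ [(L, 0), (Y, 0), (Y, 1), (M, 0), (M, 1)] = 0)
    (hΨ₁ : Ψ [(L, 0), (L, 1), (Y, 0), (Y, 1), (M, 1)] = 0)
    (hΨ₂ : Ψ [(L, 0), (L, 1), (Y, 0), (Y, 2), (M, 0)] = 0)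
    (hΨ₃ : Ψ [(L, 0), (L, 2), (Y, 0), (Y, 1), (M, 0)] = 0)
    (hΨ₄ : Ψ [(L, 0), (Y, 0), (Y, 1), (M, 0), (M, 1)] = 1)
    (hΛ₅ : Λ [(L, 0), (L, 1), (L, 2), (Y, 0), (Y, 1)] = 0)
    (hΨ₅ : Ψ [(L, 0), (L, 1), (L, 2), (Y, 0), (Y, 1)] = 0) :
    IsBasicBasis 4 ![Λ, Ψ] where
  mem := by simpa [Fin.forall_fin_two] using ⟨hΛ, hΨ⟩
  closed := by
    simpa [Fin.forall_fin_two] using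
      ⟨wordDiff_eq_zero_of_isWeightZero_five hΛ hΛ₀, wordDiff_eq_zero_of_isWeightZero_five hΨ hΨ₀⟩
  indep c G hG h := by
    have h₁ := congrFun h [(L, 0), (L, 1), (Y, 0), (Y, 1), (M, 1)]
    have h₂ := congrFun h [(L, 0), (L, 1), (Y, 0), (Y, 2), (M, 0)]
    have h₃ := congrFun h [(L, 0), (L, 2), (Y, 0), (Y, 1), (M, 0)]
    have h₄ := congrFun h [(L, 0), (Y, 0), (Y, 1), (M, 0), (M, 1)]
    obtain ⟨-, s₂, s₃, s₄, s₅⟩ := hG.1.wordDiff_five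
    simp [hΛ₁, hΛ₂, hΛ₃, hΛ₄, hΨ₁, hΨ₂, hΨ₃, hΨ₄, s₂, s₃, s₄, s₅] at h₁ h₂ h₃ h₄
    funext i
    fin_cases i
    · simp only [Fin.zero_eta, Pi.zero_apply]
      linear_combination h₁ + h₂ / 2 + 2 * h₃
    · simpa using h₄
  span F hF hF' := by
    refine span_of_weightZeroWords (by simpa [Fin.forall_fin_two] using ⟨hΛ, hΨ⟩)
      (by simpa [Fin.forall_fin_two] using ⟨hΛ₀, hΨ₀⟩) ?_ hF hF'
    intro F hF hF'
    refine ⟨![F [(L, 0), (L, 1), (Y, 0), (Y, 1), (M, 1)] +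
        F [(L, 0), (L, 1), (Y, 0), (Y, 2), (M, 0)] / 2 -
        F [(L, 0), (L, 2), (Y, 0), (Y, 1), (M, 0)], F [(L, 0), (Y, 0), (Y, 1), (M, 0), (M, 1)]],
      fun l =>
        if l = [(L, 0), (L, 1), (L, 2), (M, 0)] then
          -F [(L, 0), (L, 1), (L, 2), (Y, 0), (Y, 1)] else
        if l = [(L, 1), (Y, 0), (Y, 1), (M, 0)] then
          F [(L, 0), (L, 2), (Y, 0), (Y, 1), (M, 0)] / 2 else
        if l = [(L, 0), (L, 1), (M, 0), (M, 1)] then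
          F [(L, 0), (L, 2), (Y, 0), (Y, 1), (M, 0)] / 2 -
            F [(L, 0), (L, 1), (Y, 0), (Y, 2), (M, 0)] / 2 else 0,
      fun G hG hv => ?_⟩
    simp only [weightZeroWords_4.mem_iff, weightZeroWords_5.mem_iff, List.forall_mem_cons] at hv ⊢
    simp at hv ⊢
    obtain ⟨v₁, -, v₃, -, -, -, v₇⟩ := hv
    obtain ⟨s₁, s₂, s₃, s₄, s₅⟩ := hG.1.wordDiff_five
    simp only [hΛ₁, hΛ₂, hΛ₃, hΛ₄, hΛ₅, hΨ₁, hΨ₂, hΨ₃, hΨ₄, hΨ₅, s₁, s₂, s₃, s₄, s₅,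
      v₁, v₃, v₇]
    refine ⟨?_, ?_, ?_, ?_, ?_⟩ <;> ring

lemma isBasicBasis_six {Ω Θ : WordCochain} (hΩ : Ω ∈ wordCochains 6) (hΩ₀ : IsWeightZero Ω)
    (hΘ : Θ ∈ wordCochains 6) (hΘ₀ : IsWeightZero Θ)
    (hΩ₁ : Ω [(L, 0), (L, 1), (L, 2), (Y, 0), (Y, 1), (M, 0)] = 2)
    (hΩ₂ : Ω [(L, 0), (L, 1), (Y, 0), (Y, 1), (M, 0), (M, 1)] = 0)
    (hΘ₁ : Θ [(L, 0), (L, 1), (L, 2), (Y, 0), (Y, 1), (M, 0)] = 0)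
    (hΘ₂ : Θ [(L, 0), (L, 1), (Y, 0), (Y, 1), (M, 0), (M, 1)] = -1) :
    IsBasicBasis 5 ![Ω, Θ] where
  mem := by simpa [Fin.forall_fin_two] using ⟨hΩ, hΘ⟩
  closed := by
    simpa [Fin.forall_fin_two] using
      ⟨wordDiff_eq_zero_of_isWeightZero (by omega) hΩ hΩ₀,
        wordDiff_eq_zero_of_isWeightZero (by omega) hΘ hΘ₀⟩
  indep c G hG h := by
    have h₁ := congrFun h [(L, 0), (L, 1), (L, 2), (Y, 0), (Y, 1), (M, 0)]
    have h₂ := congrFun h [(L, 0), (L, 1), (Y, 0), (Y, 1), (M, 0), (M, 1)]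
    obtain ⟨s₁, s₂⟩ := hG.1.wordDiff_six
    simp [hΩ₁, hΩ₂, hΘ₁, hΘ₂, s₁, s₂] at h₁ h₂
    funext i
    fin_cases i
    · simpa using h₁
    · simpa using h₂
  span F hF hF' := by
    refine span_of_weightZeroWords (by simpa [Fin.forall_fin_two] using ⟨hΩ, hΘ⟩)
      (by simpa [Fin.forall_fin_two] using ⟨hΩ₀, hΘ₀⟩) ?_ hF hF'
    intro F hF hF'
    refine ⟨![F [(L, 0), (L, 1), (L, 2), (Y, 0), (Y, 1), (M, 0)] / 2,
      -F [(L, 0), (L, 1), (Y, 0), (Y, 1), (M, 0), (M, 1)]], 0, fun G hG hv => ?_⟩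
    simp only [weightZeroWords_6.mem_iff, List.forall_mem_cons]
    obtain ⟨s₁, s₂⟩ := hG.1.wordDiff_six
    simp [hΩ₁, hΩ₂, hΘ₁, hΘ₂, s₁, s₂]

lemma isBasicBasis_of_ge {q : ℕ} (hq : 6 ≤ q) : IsBasicBasis q (![] : Fin 0 → WordCochain) where
  mem i := i.elim0
  closed i := i.elim0
  indep c _ _ _ := Subsingleton.elim c 0
  span F hF hd := by
    refine span_of_weightZeroWords (fun i => i.elim0) (fun i => i.elim0) ?_ hF hd
    intro F hF hd
    refine ⟨0, 0, fun G hG hv l hl => ?_⟩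
    simp [weightZeroWords_eq_nil (show 7 ≤ q + 1 by omega)] at hl

/-- A family of cochains of degree `q + 1` representing a basis of the reduced cohomology. -/
structure IsReducedBasis (q : ℕ) {ι : Type*} [Fintype ι] (e : ι → WordCochain) : Prop where
  mem : ∀ i, e i ∈ wordCochains (q + 1)
  closed : ∀ i, ∃ φ ∈ wordCochains (q + 2), wordDiff (e i) = lieDer (L, 0) φ
  indep : ∀ c : ι → ℂ, ∀ φ ∈ wordCochains (q + 1), ∀ ψ ∈ wordCochains q,
    ∑ i, c i • e i = lieDer (L, 0) φ + wordDiff ψ → c = 0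
  span : ∀ F ∈ wordCochains (q + 1), ∀ φ ∈ wordCochains (q + 2),
    wordDiff F = lieDer (L, 0) φ → ∃ c : ι → ℂ, ∃ φ' ∈ wordCochains (q + 1),
      ∃ ψ ∈ wordCochains q, F = ∑ i, c i • e i + (lieDer (L, 0) φ' + wordDiff ψ)

/-- The reduced cohomology of degree `q + 1` is the sum of the basic cohomologies of degrees
`q + 1` and `q + 2`. -/
lemma IsBasicBasis.isReducedBasis {q : ℕ} {ι κ : Type*} [Fintype ι] [Fintype κ]
    {e : ι → WordCochain} {f fb : κ → WordCochain} (he : IsBasicBasis q e)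
    (hf : IsBasicBasis (q + 1) f)
    (hfb : ∀ j, ∃ χ ∈ wordCochains (q + 1),
      fb j = contract (L, 0) (f j) + lieDer (L, 0) χ) :
    IsReducedBasis q (Sum.elim e fb) := by
  choose χ hχ hfb using hfb
  have hD : ∀ j, wordDiff (fb j) = lieDer (L, 0) (f j + wordDiff (χ j)) := fun j => by
    have h := cartan (L, 0) (f j)
    rw [hf.closed, map_zero, zero_add] at h
    rw [hfb, map_add, ← h, map_add, lieDer_wordDiff]
  have hDsum : ∀ c : κ → ℂ, wordDiff (∑ j, c j • fb j) =
      lieDer (L, 0) (∑ j, c j • f j + wordDiff (∑ j, c j • χ j)) := fun c => by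
    simp only [map_sum, map_smul, hD, map_add, smul_add, Finset.sum_add_distrib]
  have hbar : ∀ j, fb j ∈ wordCochains (q + 1) := fun j =>
    hfb j ▸ Submodule.add_mem _ (contract_mem (hf.mem j) _) (lieDer_mem (hχ j) _)
  have hsum : ∀ c : κ → ℂ, ∑ j, c j • χ j ∈ wordCochains (q + 1) := fun c =>
    Submodule.sum_mem _ fun j _ => Submodule.smul_mem _ _ (hχ j)
  have hDe : ∀ c : ι → ℂ, wordDiff (∑ i, c i • e i) = 0 := fun c => by
    simp [map_sum, he.closed]
  refine ⟨?_, ?_, ?_, ?_⟩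
  · rintro (i | j)
    · exact he.mem i
    · exact hbar j
  · rintro (i | j)
    · exact ⟨0, Submodule.zero_mem _, by simp [he.closed]⟩
    · exact ⟨_, Submodule.add_mem _ (hf.mem j) (wordDiff_mem (hχ j)), hD j⟩
  · intro c φ hφ ψ hψ h
    rw [Fintype.sum_sum_type] at h
    simp only [Sum.elim_inl, Sum.elim_inr] at h
    have h' := congrArg wordDiff h
    rw [map_add, hDe (fun i => c (Sum.inl i)), zero_add, hDsum fun j => c (Sum.inr j),
      map_add wordDiff,
      wordDiff_wordDiff, add_zero, ← lieDer_wordDiff, ← sub_eq_zero, ← map_sub] at h'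
    have h'' := sub_eq_zero.mp (eq_zero_of_lieDer_eq_zero (Submodule.sub_mem _
      (Submodule.add_mem _ (Submodule.sum_mem _ fun j _ => Submodule.smul_mem _ _ (hf.mem j))
        (wordDiff_mem (hsum _))) (wordDiff_mem hφ)) h')
    have hr := hf.indep (fun j => c (Sum.inr j)) (φ - ∑ j, c (Sum.inr j) • χ j)
      (Submodule.sub_mem _ hφ (hsum _)) (by rw [map_sub, ← h'', add_sub_cancel_right])
    have hr' : ∀ j, c (Sum.inr j) = 0 := congrFun hr
    simp only [hr', zero_smul, Finset.sum_const_zero, add_zero, map_zero] at h h''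
    have hl := he.indep (fun i => c (Sum.inl i)) (contract (L, 0) φ + ψ)
      (Submodule.add_mem _ (contract_mem hφ _) hψ) (by
        rw [h, cartan, ← h'', map_zero, zero_add, map_add])
    funext i
    rcases i with i | j
    · exact congrFun hl i
    · exact hr' j
  · intro F hF φ hφ h
    have hdφ : wordDiff φ = 0 := by
      refine eq_zero_of_lieDer_eq_zero (wordDiff_mem hφ) ?_
      rw [lieDer_wordDiff, ← h, wordDiff_wordDiff]
    obtain ⟨c, G, hG, rfl⟩ := hf.span φ hφ hdφ
    obtain ⟨b, H, hH, hFb⟩ := he.span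
      (F - ∑ j, c j • fb j - lieDer (L, 0) (G - ∑ j, c j • χ j))
      (Submodule.sub_mem _ (Submodule.sub_mem _ hF (Submodule.sum_mem _ fun j _ =>
        Submodule.smul_mem _ _ (hbar j))) (lieDer_mem (Submodule.sub_mem _ hG (hsum c)) _)) (by
        rw [map_sub, map_sub, hDsum, h, ← lieDer_wordDiff]
        simp only [map_add, map_sub]
        abel)
    refine ⟨Sum.elim b c, G - ∑ j, c j • χ j, Submodule.sub_mem _ hG (hsum c), H, hH, ?_⟩
    rw [Fintype.sum_sum_type]
    simp only [Sum.elim_inl, Sum.elim_inr]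
    rw [sub_sub, sub_eq_iff_eq_add] at hFb
    rw [hFb]
    abel

lemma IsSkew.lieDer_ofFn {n : ℕ} {F : WordCochain} (hF : IsSkew F) (x : BasisElt)
    (p : Fin (n + 1) → BasisElt) :
    SVCA.lieDer x F (List.ofFn p) = -∑ j : Fin (n + 1), (-1 : ℂ) ^ (j : ℕ) *
      ((lieCoef x (p j) : ℂ) / 2 * F (lieElt x (p j) :: List.ofFn fun k => p (j.succAbove k))) := by
  induction n generalizing F with
  | zero => simp [List.ofFn_succ, lieDer_cons, lieDer_nil]
  | succ n ih =>
    have h : ∀ j : Fin (n + 1),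
        contract (p 0) F (lieElt x (p j.succ) :: List.ofFn fun k => p (j.succAbove k).succ) =
          -F (lieElt x (p j.succ) :: List.ofFn fun k => p (j.succ.succAbove k)) := fun j => by
      rw [List.ofFn_succ (f := fun k => p (j.succ.succAbove k))]
      simp only [Fin.succ_succAbove_zero, Fin.succ_succAbove_succ]
      exact hF [] _ _ _
    rw [List.ofFn_succ, lieDer_cons, ih (hF.contract (p 0))]
    conv_rhs => rw [Fin.sum_univ_succ]
    simp only [h, Fin.val_zero, pow_zero, one_mul, Fin.val_succ, pow_succ, Fin.succAbove_zero,
      neg_add, ← Finset.sum_neg_distrib]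
    congr 1
    · ring
    · exact Finset.sum_congr rfl fun j _ => by ring

lemma SVskip_zero {q : ℕ} (j : Fin (q + 1)) (k : Fin q) :
    SVskip 0 j.succ k = (j.succAbove k).succ := by
  rw [← Fin.succ_succAbove_succ, SVskip]
  congr 1

lemma SVskip_succ_zero {q : ℕ} (i j : Fin (q + 2)) : SVskip i.succ j.succ 0 = 0 := by
  have h : (⟨min (i.succ : ℕ) (q + 1), by omega⟩ : Fin (q + 2)) =
      (⟨min (i : ℕ) q, by omega⟩ : Fin (q + 1)).succ := by
    ext
    simp
  rw [SVskip, h, Fin.succ_succAbove_zero, Fin.succ_succAbove_zero]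

lemma SVskip_succ_succ {q : ℕ} (i j : Fin (q + 2)) (k : Fin q) :
    SVskip i.succ j.succ k.succ = (SVskip i j k).succ := by
  have h : (⟨min (i.succ : ℕ) (q + 1), by omega⟩ : Fin (q + 2)) =
      (⟨min (i : ℕ) q, by omega⟩ : Fin (q + 1)).succ := by
    ext
    simp
  rw [SVskip, h, Fin.succ_succAbove_succ, Fin.succ_succAbove_succ, SVskip]

/-- The differential of a skew word cochain as a sum over pairs. -/
lemma IsSkew.wordDiff_ofFn {n : ℕ} {F : WordCochain} (hF : IsSkew F)
    (p : Fin (n + 2) → BasisElt) :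
    SVCA.wordDiff F (List.ofFn p) = ∑ i : Fin (n + 2), ∑ j : Fin (n + 2),
      if (i : ℕ) < (j : ℕ) then (-1 : ℂ) ^ ((i : ℕ) + (j : ℕ)) *
        ((lieCoef (p i) (p j) : ℂ) / 2 *
          F (lieElt (p i) (p j) :: List.ofFn fun k => p (SVskip i j k))) else 0 := by
  have hfirst : SVCA.lieDer (p 0) F (List.ofFn fun k => p k.succ) = ∑ j : Fin (n + 2),
      if ((0 : Fin (n + 2)) : ℕ) < (j : ℕ) then
        (-1 : ℂ) ^ (((0 : Fin (n + 2)) : ℕ) + (j : ℕ)) * ((lieCoef (p 0) (p j) : ℂ) / 2 *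
          F (lieElt (p 0) (p j) :: List.ofFn fun k => p (SVskip 0 j k))) else 0 := by
    rw [hF.lieDer_ofFn]
    conv_rhs => rw [Fin.sum_univ_succ]
    simp only [SVskip_zero, Fin.val_zero, lt_self_iff_false, if_false, zero_add, Fin.val_succ,
      Nat.succ_pos, if_true, pow_succ, ← Finset.sum_neg_distrib]
    exact Finset.sum_congr rfl fun j _ => by ring
  rw [List.ofFn_succ, wordDiff_cons, hfirst, sub_eq_add_neg]
  conv_rhs => rw [Fin.sum_univ_succ]
  congr 1
  cases n with
  | zero => simp [List.ofFn_succ, wordDiff_cons, wordDiff_nil, lieDer_nil]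
  | succ n =>
    have hrec : SVCA.wordDiff (contract (p 0) F) (List.ofFn fun k => p k.succ) =
        ∑ i : Fin (n + 2), ∑ j : Fin (n + 2), if (i : ℕ) < (j : ℕ) then
          (-1 : ℂ) ^ ((i : ℕ) + (j : ℕ)) * ((lieCoef (p i.succ) (p j.succ) : ℂ) / 2 *
          contract (p 0) F (lieElt (p i.succ) (p j.succ) ::
            List.ofFn fun k => p (SVskip i j k).succ)) else 0 :=
      wordDiff_ofFn (hF.contract (p 0)) fun k => p k.succ
    have h : ∀ i j : Fin (n + 2), contract (p 0) F (lieElt (p i.succ) (p j.succ) ::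
          List.ofFn fun k => p (SVskip i j k).succ) =
        -F (lieElt (p i.succ) (p j.succ) :: List.ofFn fun k => p (SVskip i.succ j.succ k)) :=
      fun i j => by
        rw [List.ofFn_succ (f := fun k => p (SVskip i.succ j.succ k))]
        simp only [SVskip_succ_zero, SVskip_succ_succ]
        exact hF [] _ _ _
    rw [hrec, ← Finset.sum_neg_distrib]
    refine Finset.sum_congr rfl fun i _ => ?_
    conv_rhs => rw [Fin.sum_univ_succ]
    simp only [Fin.val_zero, Nat.not_lt_zero, if_false, zero_add, Fin.val_succ,
      add_lt_add_iff_right, h, ← Finset.sum_neg_distrib]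
    refine Finset.sum_congr rfl fun j _ => ?_
    split_ifs <;> ring

/-! ### Exponential coefficients of polynomials -/

section expCoeff

variable {q : ℕ}

/-- The coefficient of the divided monomial `∏ i, λᵢ ^ nᵢ / nᵢ!`. -/
noncomputable def expCoeff (n : Fin q → ℕ) : MvPolynomial (Fin q) ℂ →ₗ[ℂ] ℂ :=
  (∏ i, ((n i).factorial : ℂ)) • lcoeff ℂ (Finsupp.equivFunOnFinite.symm n)

lemma expCoeff_apply (n : Fin q → ℕ) (g : MvPolynomial (Fin q) ℂ) :
    expCoeff n g = (∏ i, ((n i).factorial : ℂ)) * g.coeff (Finsupp.equivFunOnFinite.symm n) := rfl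

lemma prod_factorial_ne_zero (n : Fin q → ℕ) : (∏ i, ((n i).factorial : ℂ)) ≠ 0 :=
  Finset.prod_ne_zero_iff.mpr fun _ _ => Nat.cast_ne_zero.mpr (Nat.factorial_ne_zero _)

lemma expCoeff_ext {g h : MvPolynomial (Fin q) ℂ} (H : ∀ n, expCoeff n g = expCoeff n h) :
    g = h := by
  ext m
  refine mul_left_cancel₀ (prod_factorial_ne_zero m) ?_
  simpa [expCoeff_apply] using H m

lemma expCoeff_C (n : Fin q → ℕ) (a : ℂ) : expCoeff n (C a) = if n = 0 then a else 0 := by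
  rw [expCoeff_apply, coeff_C]
  by_cases h : n = 0
  · subst h
    simp [Finsupp.ext_iff]
  · have h' : 0 ≠ Finsupp.equivFunOnFinite.symm n := fun h' => h <| by
      ext i
      simpa using (DFunLike.congr_fun h' i).symm
    simp [h, h']

lemma expCoeff_mul_X (n : Fin q → ℕ) (g : MvPolynomial (Fin q) ℂ) (k : Fin q) :
    expCoeff n (g * X k) = n k * expCoeff (Function.update n k (n k - 1)) g := by
  rw [expCoeff_apply, expCoeff_apply, coeff_mul_X']
  by_cases h : n k = 0
  · simp [h]
  · have h1 : Finsupp.equivFunOnFinite.symm n - Finsupp.single k 1 =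
        Finsupp.equivFunOnFinite.symm (Function.update n k (n k - 1)) := by
      ext i
      by_cases hi : i = k
      · subst hi
        simp
      · simp [hi]
    have h2 : (∏ i, ((n i).factorial : ℂ)) =
        n k * ∏ i, ((Function.update n k (n k - 1) i).factorial : ℂ) := by
      rw [← Finset.mul_prod_erase _ _ (Finset.mem_univ k),
        ← Finset.mul_prod_erase _ (fun i => ((Function.update n k (n k - 1) i).factorial : ℂ))
          (Finset.mem_univ k), ← mul_assoc]
      congr 1
      · rw [Function.update_self]
        exact_mod_cast (Nat.mul_factorial_pred h).symm
      · refine Finset.prod_congr rfl fun i hi => ?_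
        rw [Function.update_of_ne (Finset.ne_of_mem_erase hi)]
    rw [if_pos (by simpa using h), h1, h2, mul_assoc]

lemma expCoeff_rename (n : Fin q → ℕ) (σ : Equiv.Perm (Fin q)) (g : MvPolynomial (Fin q) ℂ) :
    expCoeff n (rename σ g) = expCoeff (n ∘ σ) g := by
  have h : Finsupp.equivFunOnFinite.symm n =
      Finsupp.mapDomain σ (Finsupp.equivFunOnFinite.symm (n ∘ σ)) := by
    ext i
    simp [Finsupp.mapDomain_equiv_apply]
  rw [expCoeff_apply, expCoeff_apply, h, coeff_rename_mapDomain _ σ.injective]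
  congr 1
  exact (Equiv.prod_comp σ fun i => ((n i).factorial : ℂ)).symm

lemma expCoeff_eq_zero_of_degreeOf_lt {n : Fin q → ℕ} {g : MvPolynomial (Fin q) ℂ} {i : Fin q}
    (h : g.degreeOf i < n i) : expCoeff n g = 0 := by
  by_contra hc
  have h1 := right_ne_zero_of_mul (expCoeff_apply n g ▸ hc)
  have h2 := monomial_le_degreeOf i (mem_support_iff.mpr h1)
  simp only [Finsupp.equivFunOnFinite_symm_apply_apply] at h2
  omega

lemma expCoeff_eq_zero_of_isHomogeneous {n : Fin q → ℕ} {g : MvPolynomial (Fin q) ℂ} {d : ℕ}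
    (hg : g.IsHomogeneous d) (h : ∑ i, n i ≠ d) : expCoeff n g = 0 := by
  rw [expCoeff_apply, hg.coeff_eq_zero, mul_zero]
  rw [Finsupp.degree_eq_sum]
  simpa using h

lemma cons_eq_zero_iff {m : ℕ} {n : Fin q → ℕ} :
    (Fin.cons m n : Fin (q + 1) → ℕ) = 0 ↔ m = 0 ∧ n = 0 := by
  rw [funext_iff, Fin.forall_fin_succ]
  simp [funext_iff]

lemma mul_expCoeff_cons_update {i j : Fin (q + 2)} {s : Fin q → Fin (q + 2)} (hij : i ≠ j)
    (hi : ∀ k, s k ≠ i) (hj : ∀ k, s k ≠ j) (n : Fin (q + 2) → ℕ)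
    (g : MvPolynomial (Fin (q + 1)) ℂ) {m : Fin (q + 2)} (hm : m = i ∨ m = j) :
    (n m : ℂ) * expCoeff (Fin.cons
      (Function.update n m (n m - 1) i + Function.update n m (n m - 1) j)
        fun k => Function.update n m (n m - 1) (s k)) g =
      n m * expCoeff (Fin.cons (n i + n j - 1) fun k => n (s k)) g := by
  rcases Nat.eq_zero_or_pos (n m) with h0 | h0
  · simp [h0]
  · have hm' : ∀ k, s k ≠ m := by
      rintro k rfl
      exact hm.elim (hi k) (hj k)
    have h1 : Function.update n m (n m - 1) i + Function.update n m (n m - 1) j =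
        n i + n j - 1 := by
      rcases hm with rfl | rfl
      · rw [Function.update_self, Function.update_of_ne hij.symm]
        omega
      · rw [Function.update_self, Function.update_of_ne hij]
        omega
    simp only [h1, Function.update_of_ne (hm' _)]

/-- Exponential coefficients after substituting a sum of two variables for the first one. -/
lemma expCoeff_aeval_add {i j : Fin (q + 2)} {s : Fin q → Fin (q + 2)} (hij : i ≠ j)
    (hi : ∀ k, s k ≠ i) (hj : ∀ k, s k ≠ j) (hs : Function.Injective s)
    (hcov : ∀ m, m = i ∨ m = j ∨ ∃ k, s k = m) (n : Fin (q + 2) → ℕ)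
    (g : MvPolynomial (Fin (q + 1)) ℂ) :
    expCoeff n (aeval (Fin.cons (X i + X j) fun k => X (s k) : Fin (q + 1) → MvPolynomial _ ℂ) g) =
      expCoeff (Fin.cons (n i + n j) fun k => n (s k)) g := by
  induction g using MvPolynomial.induction_on generalizing n with
  | C a =>
    have h : (Fin.cons (n i + n j) fun k => n (s k) : Fin (q + 1) → ℕ) = 0 ↔ n = 0 := by
      rw [cons_eq_zero_iff]
      simp only [funext_iff, Pi.zero_apply]
      constructor
      · rintro ⟨h, h'⟩ m
        rcases hcov m with rfl | rfl | ⟨k, rfl⟩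
        · omega
        · omega
        · exact h' k
      · exact fun h => ⟨by simp [h], fun k => h _⟩
    rw [aeval_C, algebraMap_eq, expCoeff_C, expCoeff_C]
    simp only [h]
  | add g₁ g₂ h₁ h₂ => simp only [map_add, h₁, h₂]
  | mul_X g k ih =>
    rw [map_mul, aeval_X, expCoeff_mul_X]
    refine Fin.cases ?_ (fun k => ?_) k
    · rw [Fin.cons_zero, mul_add, map_add, expCoeff_mul_X, expCoeff_mul_X, ih, ih,
        mul_expCoeff_cons_update hij hi hj n g (Or.inl rfl),
        mul_expCoeff_cons_update hij hi hj n g (Or.inr rfl), Fin.cons_zero, Fin.update_cons_zero]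
      push_cast
      ring
    · have h2 : ∀ l, Function.update n (s k) (n (s k) - 1) (s l) =
          Function.update (fun k => n (s k)) k (n (s k) - 1) l := fun l => by
        simp only [Function.update_apply, hs.eq_iff]
      rw [Fin.cons_succ, expCoeff_mul_X, ih, Fin.cons_succ, ← Fin.cons_update,
        Function.update_of_ne (hi k).symm, Function.update_of_ne (hj k).symm]
      simp only [h2]

lemma expCoeff_aeval_zero (n : Fin q → ℕ) (g : MvPolynomial (Fin (q + 1)) ℂ) :
    expCoeff n (aeval (Fin.cons 0 X : Fin (q + 1) → MvPolynomial (Fin q) ℂ) g) =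
      expCoeff (Fin.cons 0 n) g := by
  induction g using MvPolynomial.induction_on generalizing n with
  | C a =>
    rw [aeval_C, algebraMap_eq, expCoeff_C, expCoeff_C]
    simp only [cons_eq_zero_iff, true_and]
  | add g₁ g₂ h₁ h₂ => simp only [map_add, h₁, h₂]
  | mul_X g k ih =>
    rw [map_mul, aeval_X, expCoeff_mul_X]
    refine Fin.cases ?_ (fun k => ?_) k
    · simp
    · rw [Fin.cons_succ, expCoeff_mul_X, ih, Fin.cons_succ, ← Fin.cons_update]

end expCoeff

/-! ### Polynomial cochains as word cochains -/

/-- The word cochain of the exponential coefficients of a polynomial cochain. -/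
noncomputable def toWords (q : ℕ) : SVRaw q →ₗ[ℂ] WordCochain where
  toFun c := ofTuples q fun p => expCoeff (fun i => (p i).2) (c fun i => (p i).1)
  map_add' c c' := by
    funext l
    by_cases h : l.length = q
    · obtain ⟨p, rfl⟩ := exists_eq_ofFn h
      simp [ofTuples_ofFn]
    · simp [ofTuples_of_ne _ h]
  map_smul' r c := by
    funext l
    by_cases h : l.length = q
    · obtain ⟨p, rfl⟩ := exists_eq_ofFn h
      simp [ofTuples_ofFn]
    · simp [ofTuples_of_ne _ h]

lemma toWords_apply {q : ℕ} (c : SVRaw q) : toWords q c =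
    ofTuples q fun p => expCoeff (fun i => (p i).2) (c fun i => (p i).1) := rfl

lemma toWords_ofFn {q : ℕ} (c : SVRaw q) (p : Fin q → BasisElt) :
    toWords q c (List.ofFn p) = expCoeff (fun i => (p i).2) (c fun i => (p i).1) :=
  ofTuples_ofFn (fun p => expCoeff (fun i => (p i).2) (c fun i => (p i).1)) p

lemma toWords_of_ne {q : ℕ} (c : SVRaw q) {l : List BasisElt} (h : l.length ≠ q) :
    toWords q c l = 0 :=
  ofTuples_of_ne (fun p => expCoeff (fun i => (p i).2) (c fun i => (p i).1)) h

lemma toWords_injective (q : ℕ) : Function.Injective (toWords q) := fun c c' h => by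
  funext a
  refine expCoeff_ext fun n => ?_
  have := congrFun h (List.ofFn fun i => (a i, n i))
  rwa [toWords_ofFn, toWords_ofFn] at this

lemma word_ext {q : ℕ} {F G : WordCochain} (hF : ∀ l, l.length ≠ q → F l = 0)
    (hG : ∀ l, l.length ≠ q → G l = 0)
    (h : ∀ p : Fin q → BasisElt, F (List.ofFn p) = G (List.ofFn p)) : F = G := by
  funext l
  by_cases hl : l.length = q
  · obtain ⟨p, rfl⟩ := exists_eq_ofFn hl
    exact h p
  · rw [hF l hl, hG l hl]

instance : Fintype SVGen where
  elems := {L, Y, M}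
  complete a := by cases a <;> decide

lemma toWords_mem_iff {q : ℕ} {c : SVRaw q} : toWords q c ∈ wordCochains q ↔ c ∈ SVCochain q := by
  constructor
  · intro h σ a
    refine expCoeff_ext fun n => ?_
    have := h.1.apply_perm (fun i => (a i, n i)) σ
    rw [toWords_ofFn, toWords_ofFn] at this
    rw [expCoeff_rename, map_smul, smul_eq_mul]
    exact this
  · intro h
    refine ⟨toWords_apply c ▸ isSkew_ofTuples fun σ p => ?_, fun l hl => toWords_of_ne c hl,
      Finset.univ.sup fun a => Finset.univ.sup fun i => (c a).degreeOf i, ?_⟩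
    · have := congrArg (expCoeff fun i => (p i).2) (h σ fun i => (p i).1)
      rwa [expCoeff_rename, map_smul, smul_eq_mul] at this
    · rintro l ⟨x, hx, hl⟩
      by_cases hq : l.length = q
      · obtain ⟨p, rfl⟩ := exists_eq_ofFn hq
        obtain ⟨i, rfl⟩ := List.mem_ofFn.mp hx
        rw [toWords_ofFn]
        refine expCoeff_eq_zero_of_degreeOf_lt (i := i) (lt_of_le_of_lt ?_ hl)
        exact (Finset.le_sup (f := fun i => (c fun i => (p i).1).degreeOf i)
          (Finset.mem_univ i)).trans (Finset.le_sup
            (f := fun a => Finset.univ.sup fun i => (c a).degreeOf i) (Finset.mem_univ _))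
      · exact toWords_of_ne c hq

lemma exists_toWords_eq {q : ℕ} {F : WordCochain} (hF : F ∈ wordCochains q) :
    ∃ c ∈ SVCochain q, toWords q c = F := by
  obtain ⟨-, h2, N, h3⟩ := id hF
  have key : toWords q (fun a => ∑ n ∈ Fintype.piFinset fun _ : Fin q => Finset.range (N + 1),
      monomial (Finsupp.equivFunOnFinite.symm n)
        (F (List.ofFn fun i => (a i, n i)) / ∏ i, ((n i).factorial : ℂ))) = F := by
    refine word_ext (fun l => toWords_of_ne _) h2 fun p => ?_
    rw [toWords_ofFn, expCoeff_apply, coeff_sum]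
    simp only [coeff_monomial, Finsupp.equivFunOnFinite.symm.injective.eq_iff]
    rw [Finset.sum_ite_eq']
    split_ifs with h
    · rw [mul_div_cancel₀ _ (prod_factorial_ne_zero _)]
    · rw [mul_zero]
      simp only [Fintype.mem_piFinset, Finset.mem_range, not_forall, not_lt] at h
      obtain ⟨i, hi⟩ := h
      exact (h3 _ ⟨p i, List.mem_ofFn.mpr ⟨i, rfl⟩, hi⟩).symm
  exact ⟨_, toWords_mem_iff.mp (key.symm ▸ hF), key⟩

lemma doubledBracket_spec (a b : SVGen) :
    SVbrk a b = ((doubledBracket a b).1, ((doubledBracket a b).2.1 : ℂ) / 2,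
      ((doubledBracket a b).2.2 : ℂ) / 2) := by
  cases a <;> cases b <;> norm_num [SVbrk, doubledBracket]

lemma SVskip_castSucc {q : ℕ} {i : Fin (q + 1)} {j : Fin (q + 2)}
    (k : Fin q) : SVskip i.castSucc j k = j.succAbove (i.succAbove k) := by
  rw [SVskip]
  congr 2
  ext
  simp
  omega

lemma expCoeff_SVdTerm {q : ℕ} (c : SVRaw (q + 1)) (p : Fin (q + 2) → BasisElt)
    {i j : Fin (q + 2)} (hij : i < j) :
    expCoeff (fun i => (p i).2) (SVdTerm c (fun i => (p i).1) i j) =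
      (-1 : ℂ) ^ ((i : ℕ) + (j : ℕ)) * ((lieCoef (p i) (p j) : ℂ) / 2 *
        toWords (q + 1) c (lieElt (p i) (p j) :: List.ofFn fun k => p (SVskip i j k))) := by
  obtain ⟨i, rfl⟩ : ∃ i' : Fin (q + 1), i'.castSucc = i :=
    ⟨i.castPred (Fin.ne_last_of_lt hij), Fin.castSucc_castPred _ _⟩
  have hi : j.succAbove i = i.castSucc := Fin.succAbove_of_castSucc_lt _ _ hij
  have hs : (fun k => SVskip i.castSucc j k) = fun k => j.succAbove (i.succAbove k) :=
    funext (SVskip_castSucc)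
  have h₁ : ∀ k, SVskip i.castSucc j k ≠ i.castSucc := fun k => by
    rw [SVskip_castSucc, ← hi]
    exact fun h => Fin.succAbove_ne _ _ (Fin.succAbove_right_injective h)
  have h₂ : ∀ k, SVskip i.castSucc j k ≠ j := fun k => by
    rw [SVskip_castSucc]
    exact Fin.succAbove_ne _ _
  have h₃ : Function.Injective (SVskip i.castSucc j) := by
    rw [show SVskip i.castSucc j = _ from hs]
    exact Fin.succAbove_right_injective.comp Fin.succAbove_right_injective
  have h₄ : ∀ m, m = i.castSucc ∨ m = j ∨ ∃ k, SVskip i.castSucc j k = m := fun m => by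
    rcases Fin.eq_self_or_eq_succAbove j m with h | ⟨m, rfl⟩
    · exact Or.inr (Or.inl h)
    · rcases Fin.eq_self_or_eq_succAbove i m with rfl | ⟨m, rfl⟩
      · exact Or.inl hi
      · exact Or.inr (Or.inr ⟨m, SVskip_castSucc m⟩)
  set g := c (Fin.cons (SVbrk (p i.castSucc).1 (p j).1).1
    fun k => (p (SVskip i.castSucc j k)).1) with hg
  have hw : toWords (q + 1) c (lieElt (p i.castSucc) (p j) ::
      List.ofFn fun k => p (SVskip i.castSucc j k)) =
      expCoeff (Fin.cons ((p i.castSucc).2 + (p j).2 - 1)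
        fun k => (p (SVskip i.castSucc j k)).2) g := by
    rw [← List.ofFn_cons, toWords_ofFn, hg, doubledBracket_spec]
    congr 2
    all_goals
      funext k
      refine Fin.cases rfl (fun k => rfl) k
  have hX : ∀ {m}, m = i.castSucc ∨ m = j →
      expCoeff (fun i => (p i).2) (X m * aeval (Fin.cons (X i.castSucc + X j)
        fun k => X (SVskip i.castSucc j k) : Fin (q + 1) → MvPolynomial (Fin (q + 2)) ℂ) g) =
      (p m).2 * expCoeff (Fin.cons ((p i.castSucc).2 + (p j).2 - 1)
        fun k => (p (SVskip i.castSucc j k)).2) g := fun {m} hm => by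
    rw [mul_comm, expCoeff_mul_X, expCoeff_aeval_add hij.ne h₁ h₂ h₃ h₄]
    exact mul_expCoeff_cons_update hij.ne h₁ h₂ (fun i => (p i).2) g hm
  rw [SVdTerm, hw, lieCoef]
  simp only [sub_mul, add_mul, mul_add, map_smul, map_sub, map_add, ← smul_eq_C_mul,
    smul_mul_assoc]
  simp only [hg] at hX
  rw [hX (Or.inl rfl), hX (Or.inr rfl)]
  simp only [hg, doubledBracket_spec, smul_eq_mul]
  push_cast
  ring

lemma lieDer_partial_ofFn {q : ℕ} (F : WordCochain) (p : Fin q → BasisElt) :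
    lieDer (L, 0) F (List.ofFn p) =
      ∑ j, ((p j).2 : ℂ) * F (List.ofFn (Function.update p j ((p j).1, (p j).2 - 1))) := by
  induction q generalizing F with
  | zero => simp [lieDer_nil]
  | succ q ih =>
    have h1 : -((lieCoef (L, 0) (p 0) : ℂ) / 2) = (p 0).2 := by
      rcases p 0 with ⟨a | a | a, n⟩ <;> simp [lieCoef, doubledBracket] <;> ring
    have h2 : lieElt (L, 0) (p 0) = ((p 0).1, (p 0).2 - 1) := by
      rcases p 0 with ⟨a | a | a, n⟩ <;> simp [lieElt, doubledBracket]
    rw [List.ofFn_succ, lieDer_cons, ih, h1, h2, Fin.sum_univ_succ]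
    congr 1
    · simp [List.ofFn_succ]
    · refine Finset.sum_congr rfl fun j _ => ?_
      rw [contract_apply, List.ofFn_succ (f := Function.update p j.succ _),
        Function.update_of_ne (Fin.succ_ne_zero j).symm]
      congr 4
      funext k
      simp [Function.update_apply]

lemma toWords_SVpartial {q : ℕ} (c : SVRaw q) :
    toWords q (SVpartial 0 q c) = lieDer (L, 0) (toWords q c) := by
  refine word_ext (fun l => toWords_of_ne _) (fun l hl => lieDer_eq_zero_of_length _ fun l' hl' =>
    toWords_of_ne _ (hl' ▸ hl)) fun p => ?_
  rw [lieDer_partial_ofFn, toWords_ofFn]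
  simp only [SVpartial, LinearMap.coe_mk, AddHom.coe_mk, map_zero, zero_add, Finset.sum_mul,
    map_sum]
  refine Finset.sum_congr rfl fun j _ => ?_
  rw [mul_comm, expCoeff_mul_X, toWords_ofFn]
  congr 3
  · funext i
    by_cases h : i = j
    · subst h
      simp
    · simp [h]
  · funext i
    by_cases h : i = j
    · subst h
      simp
    · simp [h]

lemma toWords_SVdLin {q : ℕ} {c : SVRaw q} (hc : c ∈ SVCochain q) :
    toWords (q + 1) (SVdLin q c) = wordDiff (toWords q c) := by
  have hT := toWords_mem_iff.mpr hc
  refine word_ext (fun l => toWords_of_ne _) (wordDiff_mem hT).2.1 fun p => ?_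
  cases q with
  | zero =>
    rw [toWords_ofFn]
    simp [SVdLin, SVd, List.ofFn_succ, wordDiff_cons, lieDer_nil, wordDiff_nil]
  | succ q =>
    rw [hT.1.wordDiff_ofFn, toWords_ofFn]
    simp only [SVdLin, LinearMap.coe_mk, AddHom.coe_mk, SVd, map_sum]
    refine Finset.sum_congr rfl fun i _ => Finset.sum_congr rfl fun j _ => ?_
    split_ifs with h
    · exact expCoeff_SVdTerm c p h
    · exact map_zero _

/-- The value at `λ₁ = 0` of a cochain with `L` inserted in the first slot. -/
noncomputable def insertL {q : ℕ} (c : SVRaw (q + 1)) : SVRaw q := fun a =>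
  aeval (Fin.cons 0 X : Fin (q + 1) → MvPolynomial (Fin q) ℂ) (c (Fin.cons L a))

lemma toWords_insertL {q : ℕ} (c : SVRaw (q + 1)) :
    toWords q (insertL c) = contract (L, 0) (toWords (q + 1) c) := by
  refine word_ext (fun l => toWords_of_ne _) (fun l hl => toWords_of_ne _ (by simpa using hl))
    fun p => ?_
  rw [contract_apply, ← List.ofFn_cons, toWords_ofFn, toWords_ofFn, insertL, expCoeff_aeval_zero]
  congr 2
  all_goals
    funext k
    refine Fin.cases rfl (fun k => rfl) k

lemma insertL_mem {q : ℕ} {c : SVRaw (q + 1)} (hc : c ∈ SVCochain (q + 1)) :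
    insertL c ∈ SVCochain q := by
  rw [← toWords_mem_iff, toWords_insertL]
  exact contract_mem (toWords_mem_iff.mpr hc) _

/-! ### Reduced cohomology of polynomial cochains -/

lemma mem_SVredCocycles_iff {q : ℕ} {c : SVRaw q} :
    c ∈ SVredCocycles 0 q ↔ toWords q c ∈ wordCochains q ∧
      ∃ φ ∈ wordCochains (q + 1), wordDiff (toWords q c) = lieDer (L, 0) φ := by
  rw [SVredCocycles, Submodule.mem_inf, toWords_mem_iff]
  refine and_congr_right fun hc => ?_
  rw [← toWords_SVdLin hc]
  constructor
  · rintro ⟨φ, hφ, h⟩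
    exact ⟨toWords _ φ, toWords_mem_iff.mpr hφ, by rw [← h, toWords_SVpartial]⟩
  · rintro ⟨φ, hφ, h⟩
    obtain ⟨φ', hφ', rfl⟩ := exists_toWords_eq hφ
    exact ⟨φ', hφ', toWords_injective _ (by rw [h, toWords_SVpartial])⟩

lemma mem_SVredCoboundaries_iff {q : ℕ} {c : SVRaw (q + 1)} :
    c ∈ SVredCoboundaries 0 (q + 1) ↔ ∃ φ ∈ wordCochains (q + 1), ∃ ψ ∈ wordCochains q,
      toWords (q + 1) c = lieDer (L, 0) φ + wordDiff ψ := by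
  rw [SVredCoboundaries, Submodule.mem_sup]
  constructor
  · rintro ⟨_, ⟨φ, hφ, rfl⟩, _, ⟨ψ, hψ, rfl⟩, rfl⟩
    exact ⟨_, toWords_mem_iff.mpr hφ, _, toWords_mem_iff.mpr hψ,
      by rw [map_add, toWords_SVpartial, toWords_SVdLin hψ]⟩
  · rintro ⟨φ, hφ, ψ, hψ, h⟩
    obtain ⟨φ', hφ', rfl⟩ := exists_toWords_eq hφ
    obtain ⟨ψ', hψ', rfl⟩ := exists_toWords_eq hψ
    refine ⟨_, ⟨φ', hφ', rfl⟩, _, ⟨ψ', hψ', rfl⟩, toWords_injective _ ?_⟩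
    rw [map_add, toWords_SVpartial, toWords_SVdLin hψ', h]

/-- A basis of the reduced cohomology, built from bases of the basic cohomology in two consecutive
degrees. -/
lemma reduced_basis {q : ℕ} {ι κ : Type*} [Fintype ι] [Fintype κ] {e : ι → SVRaw (q + 1)}
    {f : κ → SVRaw (q + 2)} {fb : κ → SVRaw (q + 1)}
    (he : IsBasicBasis q fun i => toWords (q + 1) (e i))
    (hf : IsBasicBasis (q + 1) fun j => toWords (q + 2) (f j))
    (hfb : ∀ j, ∃ χ ∈ SVCochain (q + 1), fb j = insertL (f j) + SVpartial 0 (q + 1) χ) :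
    (∀ i, e i ∈ SVredCocycles 0 (q + 1)) ∧ (∀ j, fb j ∈ SVredCocycles 0 (q + 1)) ∧
      (∀ (c : ι → ℂ) (c' : κ → ℂ), ∑ i, c i • e i + ∑ j, c' j • fb j ∈
        SVredCoboundaries 0 (q + 1) → c = 0 ∧ c' = 0) ∧
      ∀ γ ∈ SVredCocycles 0 (q + 1), ∃ (c : ι → ℂ) (c' : κ → ℂ),
        γ - (∑ i, c i • e i + ∑ j, c' j • fb j) ∈ SVredCoboundaries 0 (q + 1) := by
  have H := he.isReducedBasis (fb := fun j => toWords (q + 1) (fb j)) hf fun j => by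
    obtain ⟨χ, hχ, h⟩ := hfb j
    exact ⟨_, toWords_mem_iff.mpr hχ, by rw [h, map_add, toWords_insertL, toWords_SVpartial]⟩
  refine ⟨fun i => mem_SVredCocycles_iff.mpr ⟨H.mem (Sum.inl i), H.closed (Sum.inl i)⟩,
    fun j => mem_SVredCocycles_iff.mpr ⟨H.mem (Sum.inr j), H.closed (Sum.inr j)⟩,
    fun c c' h => ?_, fun γ hγ => ?_⟩
  · obtain ⟨φ, hφ, ψ, hψ, h⟩ := mem_SVredCoboundaries_iff.mp h
    have := H.indep (Sum.elim c c') φ hφ ψ hψ (by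
      rw [← h, map_add]
      simp [map_sum])
    exact ⟨funext fun i => congrFun this (Sum.inl i), funext fun j => congrFun this (Sum.inr j)⟩
  · obtain ⟨h₁, φ, hφ, h₂⟩ := mem_SVredCocycles_iff.mp hγ
    obtain ⟨c, φ', hφ', ψ, hψ, h⟩ := H.span _ h₁ φ hφ h₂
    refine ⟨c ∘ Sum.inl, c ∘ Sum.inr, mem_SVredCoboundaries_iff.mpr ⟨φ', hφ', ψ, hψ, ?_⟩⟩
    rw [map_sub, h, map_add]
    simp [map_sum]

/-! ### Cochains prescribed on one tuple of generators -/

lemma sum_X_ne_zero (q : ℕ) : (∑ i, X i : MvPolynomial (Fin (q + 1)) ℂ) ≠ 0 := fun h => by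
  have := congrArg (eval fun _ => (1 : ℂ)) h
  simp only [map_sum, eval_X, Finset.sum_const, Finset.card_univ, Fintype.card_fin, nsmul_eq_mul,
    mul_one, map_zero, Nat.cast_eq_zero] at this
  omega

lemma rename_sum_X {q : ℕ} (σ : Equiv.Perm (Fin q)) :
    rename σ (∑ i, X i : MvPolynomial (Fin q) ℂ) = ∑ i, X i := by
  simp only [map_sum, rename_X]
  exact Equiv.sum_comp σ fun i => (X i : MvPolynomial (Fin q) ℂ)

lemma exists_SVpartial_eq {q : ℕ} {δ : SVRaw (q + 1)} (hδ : δ ∈ SVCochain (q + 1))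
    (h : ∀ a, (∑ i, X i) ∣ δ a) : ∃ χ ∈ SVCochain (q + 1), δ = SVpartial 0 (q + 1) χ := by
  choose χ hχ using h
  refine ⟨χ, fun σ a => mul_left_cancel₀ (sum_X_ne_zero q) ?_, funext fun a => ?_⟩
  · have := hδ σ a
    rw [hχ, hχ, map_mul, rename_sum_X] at this
    rw [this, mul_smul_comm]
  · simp [SVpartial, hχ]

lemma dvd_of_dvd_pattern {q : ℕ} {δ : SVRaw q} (hδ : δ ∈ SVCochain q) {b : Fin q → SVGen}
    (h0 : ∀ a, (¬ ∃ σ : Equiv.Perm (Fin q), a = b ∘ σ) → δ a = 0) (hb : (∑ i, X i) ∣ δ b)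
    (a : Fin q → SVGen) : (∑ i, X i) ∣ δ a := by
  by_cases h : ∃ σ : Equiv.Perm (Fin q), a = b ∘ σ
  · obtain ⟨σ, rfl⟩ := h
    have h1 := congrArg (rename (σ⁻¹ : Equiv.Perm (Fin q))) (hδ σ b)
    rw [rename_rename, map_smul, ← Equiv.Perm.coe_mul, inv_mul_cancel, Equiv.Perm.coe_one,
      rename_id_apply] at h1
    rw [h1, smul_eq_C_mul]
    refine Dvd.dvd.mul_left ?_ _
    simpa only [rename_sum_X] using map_dvd (rename (σ⁻¹ : Equiv.Perm (Fin q))) hb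
  · exact h0 a h ▸ dvd_zero _

lemma exists_perm_of_cons {q : ℕ} {a b : Fin q → SVGen}
    (h : ∃ σ : Equiv.Perm (Fin (q + 1)),
      (Fin.cons L a : Fin (q + 1) → SVGen) = (Fin.cons L b : Fin (q + 1) → SVGen) ∘ σ) :
    ∃ σ : Equiv.Perm (Fin q), a = b ∘ σ := by
  obtain ⟨σ, hσ⟩ := h
  obtain ⟨⟨p, τ⟩, rfl⟩ := Equiv.Perm.decomposeFin.symm.surjective σ
  have hp : (Fin.cons L b : Fin (q + 1) → SVGen) p = L := by
    simpa using (congrFun hσ 0).symm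
  refine ⟨τ, funext fun i => ?_⟩
  have hi := congrFun hσ i.succ
  rw [Fin.cons_succ, Function.comp_apply, Equiv.Perm.decomposeFin_symm_apply_succ] at hi
  rw [hi, Equiv.swap_apply_def, if_neg (Fin.succ_ne_zero _)]
  split_ifs with h
  · rw [Fin.cons_zero, ← hp, ← h, Fin.cons_succ, Function.comp_apply]
  · rw [Fin.cons_succ, Function.comp_apply]

lemma exists_eq_insertL_add {q : ℕ} {c : SVRaw (q + 2)} {cb : SVRaw (q + 1)}
    {b : Fin (q + 1) → SVGen} (hc : c ∈ SVCochain (q + 2)) (hcb : cb ∈ SVCochain (q + 1))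
    (hc0 : ∀ a, (¬ ∃ σ : Equiv.Perm (Fin (q + 2)),
      a = (Fin.cons L b : Fin (q + 2) → SVGen) ∘ σ) → c a = 0)
    (hcb0 : ∀ a, (¬ ∃ σ : Equiv.Perm (Fin (q + 1)), a = b ∘ σ) → cb a = 0)
    (h : (∑ i, X i) ∣ cb b - insertL c b) :
    ∃ χ ∈ SVCochain (q + 1), cb = insertL c + SVpartial 0 (q + 1) χ := by
  have hδ := Submodule.sub_mem _ hcb (insertL_mem hc)
  obtain ⟨χ, hχ, hχ'⟩ := exists_SVpartial_eq hδ (dvd_of_dvd_pattern hδ (fun a ha => by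
    rw [Pi.sub_apply, hcb0 a ha, insertL, hc0 _ (mt exists_perm_of_cons ha), map_zero, sub_zero]) h)
  exact ⟨χ, hχ, by rw [← hχ', add_sub_cancel]⟩

lemma isWeightZero_toWords {q : ℕ} {c : SVRaw q} {b : Fin q → SVGen} {d : ℕ}
    (hc : c ∈ SVCochain q) (h0 : ∀ a, (¬ ∃ σ : Equiv.Perm (Fin q), a = b ∘ σ) → c a = 0)
    (hd : (c b).IsHomogeneous d) (hw : 2 * (d : ℤ) + ∑ i, weight (b i, 0) = 0) :
    IsWeightZero (toWords q c) := by
  intro l hl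
  by_cases hq : l.length = q
  · obtain ⟨p, rfl⟩ := exists_eq_ofFn hq
    by_cases h : ∃ σ : Equiv.Perm (Fin q), (fun i => (p i).1) = b ∘ σ
    · obtain ⟨σ, hσ⟩ := h
      have hp : p = (fun i => (b i, (p (σ⁻¹ i)).2)) ∘ σ := by
        funext i
        exact Prod.ext (congrFun hσ i) (by simp)
      rw [hp, (toWords_mem_iff.mpr hc).1.apply_perm, toWords_ofFn,
        expCoeff_eq_zero_of_isHomogeneous hd, mul_zero]
      intro hn
      refine hl ?_
      have hx : ∀ x : BasisElt, weight x = weight (x.1, 0) + 2 * (x.2 : ℤ) := by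
        rintro ⟨a | a | a, n⟩ <;> simp [weight] <;> ring
      have h1 : ∑ i, weight (p i) = ∑ i, weight (b i, (p (σ⁻¹ i)).2) := by
        conv_lhs => rw [hp]
        exact Equiv.sum_comp σ fun i => weight (b i, (p (σ⁻¹ i)).2)
      rw [wordWeight, List.map_ofFn, List.sum_ofFn]
      simp only [Function.comp_apply, h1]
      simp only [fun i => hx (b i, (p (σ⁻¹ i)).2), Finset.sum_add_distrib, ← Finset.mul_sum]
      rw [← hn] at hw
      push_cast at hw
      linarith
    · rw [toWords_ofFn, h0 _ h, map_zero]
  · exact toWords_of_ne c hq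

lemma toWords_eq_zero_of_not_perm {q : ℕ} {c : SVRaw q} {b : Fin q → SVGen}
    (h0 : ∀ a, (¬ ∃ σ : Equiv.Perm (Fin q), a = b ∘ σ) → c a = 0) {l : List BasisElt}
    (hl : ¬ (l.map Prod.fst).Perm (List.ofFn b)) : toWords q c l = 0 := by
  by_cases hq : l.length = q
  · obtain ⟨p, rfl⟩ := exists_eq_ofFn hq
    rw [toWords_ofFn, h0, map_zero]
    rintro ⟨σ, hσ⟩
    refine hl ?_
    rw [List.map_ofFn, show Prod.fst ∘ p = b ∘ σ from hσ]
    exact σ.ofFn_comp_perm b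
  · exact toWords_of_ne c hq

/-! ### The cochains `Φ` and `Φ̄` -/

lemma const_mem_SVCochain {q : ℕ} {g : MvPolynomial (Fin q) ℂ}
    (hg : ∀ σ : Equiv.Perm (Fin q), rename σ g = ((Equiv.Perm.sign σ : ℤ) : ℂ) • g)
    {b : Fin q → SVGen} {x : SVGen} (hb : b = fun _ => x) :
    (fun a => if a = b then g else 0) ∈ SVCochain q := by
  subst hb
  intro σ a
  have h : (a ∘ σ = fun _ => x) ↔ a = fun _ => x := by
    refine ⟨fun h => funext fun i => ?_, by rintro rfl; rfl⟩
    simpa using congrFun h (σ⁻¹ i)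
  by_cases ha : a = fun _ => x
  · simp only [h, if_pos ha, hg]
  · simp [h, ha]

lemma rename_det_pow {q : ℕ} (e : Fin q → ℕ) (σ : Equiv.Perm (Fin q)) :
    rename σ (Matrix.of fun i j => (X i ^ e j : MvPolynomial (Fin q) ℂ)).det =
      ((Equiv.Perm.sign σ : ℤ) : ℂ) •
        (Matrix.of fun i j => (X i ^ e j : MvPolynomial (Fin q) ℂ)).det := by
  have h := Matrix.det_permute σ (Matrix.of fun i j => (X i ^ e j : MvPolynomial (Fin q) ℂ))
  rw [AlgHom.map_det, smul_eq_C_mul, map_intCast, ← h]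
  congr 1
  ext1 i j
  simp [AlgHom.mapMatrix_apply]

lemma SVPhi_mem : SVPhi ∈ SVCochain 3 := by
  refine const_mem_SVCochain (x := L) (fun σ => ?_) (by ext i; fin_cases i <;> rfl)
  have h : (X 0 - X 1) * (X 0 - X 2) * (X 1 - X 2) =
      -(Matrix.of fun i j => (X i ^ ![0, 1, 2] j : MvPolynomial (Fin 3) ℂ)).det := by
    simp [Matrix.det_fin_three]
    ring
  rw [h, map_neg, rename_det_pow, smul_neg]

lemma SVPhiBar_mem : SVPhiBar ∈ SVCochain 2 := by
  refine const_mem_SVCochain (x := L) (fun σ => ?_) (by ext i; fin_cases i <;> rfl)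
  have h : -(X 0) ^ 3 + (X 1) ^ 3 =
      (Matrix.of fun i j => (X i ^ ![0, 3] j : MvPolynomial (Fin 2) ℂ)).det := by
    simp [Matrix.det_fin_two]
    ring
  rw [h, rename_det_pow]

lemma SVPhi_eq_zero (a : Fin 3 → SVGen)
    (h : ¬ ∃ σ : Equiv.Perm (Fin 3), a = ![L, L, L] ∘ σ) : SVPhi a = 0 :=
  if_neg fun ha => h ⟨1, ha⟩

lemma SVPhiBar_eq_zero (a : Fin 2 → SVGen)
    (h : ¬ ∃ σ : Equiv.Perm (Fin 2), a = ![L, L] ∘ σ) : SVPhiBar a = 0 :=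
  if_neg fun ha => h ⟨1, ha⟩

/-! ### Values on words of weight zero -/

lemma expCoeff_X {q : ℕ} (n : Fin q → ℕ) (k : Fin q) :
    expCoeff n (X k) = n k * expCoeff (Function.update n k (n k - 1)) 1 := by
  rw [← expCoeff_mul_X, one_mul]

lemma expCoeff_one {q : ℕ} (n : Fin q → ℕ) : expCoeff n 1 = if n = 0 then 1 else 0 := by
  rw [← C_1, expCoeff_C]

lemma isHomogeneous_X_sub_X {q : ℕ} (i j : Fin q) :
    (X i - X j : MvPolynomial (Fin q) ℂ).IsHomogeneous 1 :=
  (isHomogeneous_X _ _).sub (isHomogeneous_X _ _)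

lemma isWeightZero_SVPhi : IsWeightZero (toWords 3 SVPhi) :=
  isWeightZero_toWords SVPhi_mem SVPhi_eq_zero
    (((isHomogeneous_X_sub_X 0 1).mul (isHomogeneous_X_sub_X 0 2)).mul (isHomogeneous_X_sub_X 1 2))
    (by simp [Fin.sum_univ_succ, weight])

lemma isBasicBasis_SVPhi : IsBasicBasis 2 ![toWords 3 SVPhi] := by
  have hm := toWords_mem_iff.mpr SVPhi_mem
  refine isBasicBasis_three hm isWeightZero_SVPhi
    (eq_zero_of_weightZeroWords (wordDiff_mem hm) isWeightZero_SVPhi.wordDiff ?_) ?_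
  · simp only [weightZeroWords_4.mem_iff, List.forall_mem_cons, hm.1.wordDiff_four]
    have h : ∀ l : List BasisElt, ¬ (l.map Prod.fst).Perm [L, L, L] → toWords 3 SVPhi l = 0 :=
      fun l hl => toWords_eq_zero_of_not_perm SVPhi_eq_zero hl
    simp [h _ (show ¬ ([(L, 1), (Y, 0), (Y, 1)].map Prod.fst).Perm [L, L, L] by decide),
      h _ (show ¬ ([(L, 0), (L, 1), (M, 1)].map Prod.fst).Perm [L, L, L] by decide),
      h _ (show ¬ ([(L, 0), (L, 2), (M, 0)].map Prod.fst).Perm [L, L, L] by decide),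
      h _ (show ¬ ([(Y, 0), (Y, 1), (M, 0)].map Prod.fst).Perm [L, L, L] by decide),
      h _ (show ¬ ([(L, 0), (M, 0), (M, 1)].map Prod.fst).Perm [L, L, L] by decide)]
  · have h : toWords 3 SVPhi [(L, 0), (L, 1), (L, 2)] = -2 := by
      refine (toWords_ofFn _ fun i => (![L, L, L] i, ![0, 1, 2] i)).trans ?_
      simp [SVPhi, sub_mul, mul_sub, expCoeff_mul_X, expCoeff_X, expCoeff_one]
      decide
    simp [h]

lemma isBasicBasis_Λ_Ψ {Λ Ψ : SVRaw 5} (hΛ : Λ ∈ SVCochain 5)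
    (hΛv : Λ ![L, L, Y, Y, M] = (X 0 - X 1) * (X 2 - X 3) * X 4)
    (hΛ₀ : ∀ a, (¬ ∃ σ : Equiv.Perm (Fin 5), a = ![L, L, Y, Y, M] ∘ σ) → Λ a = 0)
    (hΨ : Ψ ∈ SVCochain 5) (hΨv : Ψ ![L, Y, Y, M, M] = (X 1 - X 2) * (X 3 - X 4))
    (hΨ₀ : ∀ a, (¬ ∃ σ : Equiv.Perm (Fin 5), a = ![L, Y, Y, M, M] ∘ σ) → Ψ a = 0) :
    IsBasicBasis 4 ![toWords 5 Λ, toWords 5 Ψ] := by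
  refine isBasicBasis_five (toWords_mem_iff.mpr hΛ) (isWeightZero_toWords hΛ hΛ₀ (hΛv ▸
      ((isHomogeneous_X_sub_X _ _).mul (isHomogeneous_X_sub_X _ _)).mul (isHomogeneous_X _ _)) ?_)
    (toWords_mem_iff.mpr hΨ) (isWeightZero_toWords hΨ hΨ₀ (hΨv ▸
      (isHomogeneous_X_sub_X _ _).mul (isHomogeneous_X_sub_X _ _)) ?_)
    ?_ ?_ ?_ (toWords_eq_zero_of_not_perm hΛ₀ (by decide))
    (toWords_eq_zero_of_not_perm hΨ₀ (by decide)) (toWords_eq_zero_of_not_perm hΨ₀ (by decide))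
    (toWords_eq_zero_of_not_perm hΨ₀ (by decide)) ?_ (toWords_eq_zero_of_not_perm hΛ₀ (by decide))
    (toWords_eq_zero_of_not_perm hΨ₀ (by decide))
  · simp [Fin.sum_univ_succ, weight]
  · simp [Fin.sum_univ_succ, weight]
  · refine (toWords_ofFn Λ fun i => (![L, L, Y, Y, M] i, ![0, 1, 0, 1, 1] i)).trans ?_
    simp [hΛv, sub_mul, mul_sub, expCoeff_mul_X, expCoeff_X, expCoeff_one]
    decide
  · refine (toWords_ofFn Λ fun i => (![L, L, Y, Y, M] i, ![0, 1, 0, 2, 0] i)).trans ?_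
    simp [hΛv, sub_mul, mul_sub, expCoeff_mul_X]
  · refine (toWords_ofFn Λ fun i => (![L, L, Y, Y, M] i, ![0, 2, 0, 1, 0] i)).trans ?_
    simp [hΛv, sub_mul, mul_sub, expCoeff_mul_X]
  · refine (toWords_ofFn Ψ fun i => (![L, Y, Y, M, M] i, ![0, 0, 1, 0, 1] i)).trans ?_
    simp [hΨv, sub_mul, mul_sub, expCoeff_mul_X, expCoeff_X, expCoeff_one]
    decide

lemma isBasicBasis_Ω_Θ {Ω Θ : SVRaw 6} (hΩ : Ω ∈ SVCochain 6)
    (hΩv : Ω ![L, L, L, Y, Y, M] = (X 0 - X 1) * (X 0 - X 2) * (X 1 - X 2) * (X 3 - X 4))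
    (hΩ₀ : ∀ a, (¬ ∃ σ : Equiv.Perm (Fin 6), a = ![L, L, L, Y, Y, M] ∘ σ) → Ω a = 0)
    (hΘ : Θ ∈ SVCochain 6)
    (hΘv : Θ ![L, L, Y, Y, M, M] = (X 0 - X 1) * (X 2 - X 3) * (X 4 - X 5))
    (hΘ₀ : ∀ a, (¬ ∃ σ : Equiv.Perm (Fin 6), a = ![L, L, Y, Y, M, M] ∘ σ) → Θ a = 0) :
    IsBasicBasis 5 ![toWords 6 Ω, toWords 6 Θ] := by
  refine isBasicBasis_six (toWords_mem_iff.mpr hΩ) (isWeightZero_toWords hΩ hΩ₀ (hΩv ▸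
      (((isHomogeneous_X_sub_X _ _).mul (isHomogeneous_X_sub_X _ _)).mul
        (isHomogeneous_X_sub_X _ _)).mul (isHomogeneous_X_sub_X _ _)) ?_)
    (toWords_mem_iff.mpr hΘ) (isWeightZero_toWords hΘ hΘ₀ (hΘv ▸
      ((isHomogeneous_X_sub_X _ _).mul (isHomogeneous_X_sub_X _ _)).mul
        (isHomogeneous_X_sub_X _ _)) ?_)
    ?_ (toWords_eq_zero_of_not_perm hΩ₀ (by decide))
    (toWords_eq_zero_of_not_perm hΘ₀ (by decide)) ?_
  · simp [Fin.sum_univ_succ, weight]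
  · simp [Fin.sum_univ_succ, weight]
  · refine (toWords_ofFn Ω fun i => (![L, L, L, Y, Y, M] i, ![0, 1, 2, 0, 1, 0] i)).trans ?_
    simp [hΩv, sub_mul, mul_sub, expCoeff_mul_X, expCoeff_X, expCoeff_one]
    decide
  · refine (toWords_ofFn Θ fun i => (![L, L, Y, Y, M, M] i, ![0, 1, 0, 1, 0, 1] i)).trans ?_
    simp [hΘv, sub_mul, mul_sub, expCoeff_mul_X, expCoeff_X, expCoeff_one]
    decide

/-! ### Reduced cochains and their basic counterparts -/

lemma insertL_apply {q : ℕ} (c : SVRaw (q + 1)) (a : Fin q → SVGen) :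
    insertL c a = aeval (Matrix.vecCons 0 X : Fin (q + 1) → MvPolynomial (Fin q) ℂ)
      (c (Matrix.vecCons L a)) := rfl

lemma exists_SVPhiBar_eq :
    ∃ χ ∈ SVCochain 2, SVPhiBar = insertL SVPhi + SVpartial 0 2 χ := by
  refine exists_eq_insertL_add SVPhi_mem SVPhiBar_mem SVPhi_eq_zero SVPhiBar_eq_zero
    ⟨-(X 0 - X 1) * (X 0 + X 1), ?_⟩
  rw [insertL_apply, SVPhi, if_pos rfl, SVPhiBar, if_pos rfl]
  simp [Fin.sum_univ_succ]
  ring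

lemma exists_Λbar_eq {Λ : SVRaw 5} {Λbar : SVRaw 4} (hc : Λ ∈ SVCochain 5)
    (hv : Λ ![L, L, Y, Y, M] = (X 0 - X 1) * (X 2 - X 3) * X 4)
    (h0 : ∀ a, (¬ ∃ σ : Equiv.Perm (Fin 5), a = ![L, L, Y, Y, M] ∘ σ) → Λ a = 0)
    (hbc : Λbar ∈ SVCochain 4) (hbv : Λbar ![L, Y, Y, M] = (X 1 + X 2 + X 3) * (X 1 - X 2) * X 3)
    (hb0 : ∀ a, (¬ ∃ σ : Equiv.Perm (Fin 4), a = ![L, Y, Y, M] ∘ σ) → Λbar a = 0) :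
    ∃ χ ∈ SVCochain 4, Λbar = insertL Λ + SVpartial 0 4 χ := by
  refine exists_eq_insertL_add hc hbc h0 hb0 ⟨(X 1 - X 2) * X 3, ?_⟩
  rw [insertL_apply, hv, hbv]
  simp [Fin.sum_univ_succ]
  ring

lemma exists_Ψbar_eq {Ψ : SVRaw 5} {Ψbar : SVRaw 4} (hc : Ψ ∈ SVCochain 5)
    (hv : Ψ ![L, Y, Y, M, M] = (X 1 - X 2) * (X 3 - X 4))
    (h0 : ∀ a, (¬ ∃ σ : Equiv.Perm (Fin 5), a = ![L, Y, Y, M, M] ∘ σ) → Ψ a = 0)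
    (hbc : Ψbar ∈ SVCochain 4) (hbv : Ψbar ![Y, Y, M, M] = (X 0 - X 1) * (X 2 - X 3))
    (hb0 : ∀ a, (¬ ∃ σ : Equiv.Perm (Fin 4), a = ![Y, Y, M, M] ∘ σ) → Ψbar a = 0) :
    ∃ χ ∈ SVCochain 4, Ψbar = insertL Ψ + SVpartial 0 4 χ := by
  refine exists_eq_insertL_add hc hbc h0 hb0 ⟨0, ?_⟩
  rw [insertL_apply, hv, hbv]
  simp [Fin.sum_univ_succ]

lemma exists_Ωbar_eq {Ω : SVRaw 6} {Ωbar : SVRaw 5} (hc : Ω ∈ SVCochain 6)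
    (hv : Ω ![L, L, L, Y, Y, M] = (X 0 - X 1) * (X 0 - X 2) * (X 1 - X 2) * (X 3 - X 4))
    (h0 : ∀ a, (¬ ∃ σ : Equiv.Perm (Fin 6), a = ![L, L, L, Y, Y, M] ∘ σ) → Ω a = 0)
    (hbc : Ωbar ∈ SVCochain 5) (hbv : Ωbar ![L, L, Y, Y, M] = (X 0 - X 1) * (X 2 - X 3) *
      (X 0 * X 1 - (X 0 + X 1) * (X 0 + X 1 + X 2 + X 3 + X 4)))
    (hb0 : ∀ a, (¬ ∃ σ : Equiv.Perm (Fin 5), a = ![L, L, Y, Y, M] ∘ σ) → Ωbar a = 0) :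
    ∃ χ ∈ SVCochain 5, Ωbar = insertL Ω + SVpartial 0 5 χ := by
  refine exists_eq_insertL_add hc hbc h0 hb0 ⟨-(X 0 + X 1) * (X 0 - X 1) * (X 2 - X 3), ?_⟩
  rw [insertL_apply, hv, hbv]
  simp [Fin.sum_univ_succ]
  ring

lemma exists_Θbar_eq {Θ : SVRaw 6} {Θbar : SVRaw 5} (hc : Θ ∈ SVCochain 6)
    (hv : Θ ![L, L, Y, Y, M, M] = (X 0 - X 1) * (X 2 - X 3) * (X 4 - X 5))
    (h0 : ∀ a, (¬ ∃ σ : Equiv.Perm (Fin 6), a = ![L, L, Y, Y, M, M] ∘ σ) → Θ a = 0)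
    (hbc : Θbar ∈ SVCochain 5)
    (hbv : Θbar ![L, Y, Y, M, M] = (X 1 - X 2) * (X 3 - X 4) * (X 1 + X 2 + X 3 + X 4))
    (hb0 : ∀ a, (¬ ∃ σ : Equiv.Perm (Fin 5), a = ![L, Y, Y, M, M] ∘ σ) → Θbar a = 0) :
    ∃ χ ∈ SVCochain 5, Θbar = insertL Θ + SVpartial 0 5 χ := by
  refine exists_eq_insertL_add hc hbc h0 hb0 ⟨(X 1 - X 2) * (X 3 - X 4), ?_⟩
  rw [insertL_apply, hv, hbv]
  simp [Fin.sum_univ_succ]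
  ring

lemma IsBasicBasis.toWords_nil {q : ℕ} (h : IsBasicBasis q (![] : Fin 0 → WordCochain)) :
    IsBasicBasis q fun i => toWords (q + 1) ((![] : Fin 0 → SVRaw (q + 1)) i) := by
  convert h

lemma SVredCocycles_le {q : ℕ} (h : IsBasicBasis q (![] : Fin 0 → WordCochain))
    (h' : IsBasicBasis (q + 1) (![] : Fin 0 → WordCochain)) :
    SVredCocycles 0 (q + 1) ≤ SVredCoboundaries 0 (q + 1) := fun γ hγ => by
  obtain ⟨-, -, -, h⟩ := reduced_basis h.toWords_nil h'.toWords_nil (fb := ![]) fun i => i.elim0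
  simpa using h γ hγ

lemma nonempty_SVredH_zero_equiv : Nonempty (SVredH 0 0 ≃ₗ[ℂ] ℂ) := by
  have h₁ : SVredCocycles 0 0 = ⊤ := by
    refine top_unique fun c _ => ⟨fun σ a => ?_, 0, Submodule.zero_mem _, ?_⟩
    · simp [Subsingleton.elim σ 1]
    · rw [map_zero]
      rfl
  have h₂ : SVredCoboundaries 0 0 = ⊥ := by
    rw [SVredCoboundaries, SVpartialSub, show SVpartial 0 0 = 0 from ?_, Submodule.map_zero]
    refine LinearMap.ext fun c => funext fun a => ?_
    simp [SVpartial]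
  have e₁ : SVredH 0 0 ≃ₗ[ℂ] SVredCocycles 0 0 :=
    Submodule.quotEquivOfEqBot _ (by rw [h₂, Submodule.comap_bot, Submodule.ker_subtype])
  have e₂ : SVredCocycles 0 0 ≃ₗ[ℂ] SVRaw 0 := LinearEquiv.ofTop _ h₁
  exact ⟨e₁ ≪≫ₗ e₂ ≪≫ₗ LinearEquiv.funUnique _ ℂ _ ≪≫ₗ
    (isEmptyAlgEquiv ℂ (Fin 0)).toLinearEquiv⟩

open SVGen in
/-- Explicit bases for the reduced cohomology
`H^q(SV,ℂ)`: `H⁰ = ℂ`, `H² = ℂ(Φ̄)`, `H³ = ℂ(Φ)`, `H⁴ = ℂ(Λ̄) ⊕ ℂ(Ψ̄)`,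
`H⁵ = ℂ(Λ) ⊕ ℂ(Ψ) ⊕ ℂ(Ω̄) ⊕ ℂ(Θ̄)`, `H⁶ = ℂ(Ω) ⊕ ℂ(Θ)`, and `H^q = 0`
otherwise.  (Each cochain below is prescribed by its value on the displayed
tuple of generators, and vanishes on every tuple of generators which is not a
permutation of the displayed one.) -/
theorem statement15 (Λbar : SVRaw 4) (Ψbar : SVRaw 4)
    (Λ Ψ Ωbar Θbar : SVRaw 5) (Ω Θ : SVRaw 6)
    (hΛbc : Λbar ∈ SVCochain 4)
    (hΛbv : Λbar ![L, Y, Y, M] = (X 1 + X 2 + X 3) * (X 1 - X 2) * X 3)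
    (hΛb0 : ∀ a : Fin 4 → SVGen,
      (¬ ∃ σ : Equiv.Perm (Fin 4), a = ![L, Y, Y, M] ∘ σ) → Λbar a = 0)
    (hΨbc : Ψbar ∈ SVCochain 4)
    (hΨbv : Ψbar ![Y, Y, M, M] = (X 0 - X 1) * (X 2 - X 3))
    (hΨb0 : ∀ a : Fin 4 → SVGen,
      (¬ ∃ σ : Equiv.Perm (Fin 4), a = ![Y, Y, M, M] ∘ σ) → Ψbar a = 0)
    (hΛc : Λ ∈ SVCochain 5)
    (hΛv : Λ ![L, L, Y, Y, M] = (X 0 - X 1) * (X 2 - X 3) * X 4)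
    (hΛ0 : ∀ a : Fin 5 → SVGen,
      (¬ ∃ σ : Equiv.Perm (Fin 5), a = ![L, L, Y, Y, M] ∘ σ) → Λ a = 0)
    (hΨc : Ψ ∈ SVCochain 5)
    (hΨv : Ψ ![L, Y, Y, M, M] = (X 1 - X 2) * (X 3 - X 4))
    (hΨ0 : ∀ a : Fin 5 → SVGen,
      (¬ ∃ σ : Equiv.Perm (Fin 5), a = ![L, Y, Y, M, M] ∘ σ) → Ψ a = 0)
    (hΩbc : Ωbar ∈ SVCochain 5)
    (hΩbv : Ωbar ![L, L, Y, Y, M] = (X 0 - X 1) * (X 2 - X 3) *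
      (X 0 * X 1 - (X 0 + X 1) * (X 0 + X 1 + X 2 + X 3 + X 4)))
    (hΩb0 : ∀ a : Fin 5 → SVGen,
      (¬ ∃ σ : Equiv.Perm (Fin 5), a = ![L, L, Y, Y, M] ∘ σ) → Ωbar a = 0)
    (hΘbc : Θbar ∈ SVCochain 5)
    (hΘbv : Θbar ![L, Y, Y, M, M] = (X 1 - X 2) * (X 3 - X 4) *
      (X 1 + X 2 + X 3 + X 4))
    (hΘb0 : ∀ a : Fin 5 → SVGen,
      (¬ ∃ σ : Equiv.Perm (Fin 5), a = ![L, Y, Y, M, M] ∘ σ) → Θbar a = 0)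
    (hΩc : Ω ∈ SVCochain 6)
    (hΩv : Ω ![L, L, L, Y, Y, M] =
      (X 0 - X 1) * (X 0 - X 2) * (X 1 - X 2) * (X 3 - X 4))
    (hΩ0 : ∀ a : Fin 6 → SVGen,
      (¬ ∃ σ : Equiv.Perm (Fin 6), a = ![L, L, L, Y, Y, M] ∘ σ) → Ω a = 0)
    (hΘc : Θ ∈ SVCochain 6)
    (hΘv : Θ ![L, L, Y, Y, M, M] = (X 0 - X 1) * (X 2 - X 3) * (X 4 - X 5))
    (hΘ0 : ∀ a : Fin 6 → SVGen,
      (¬ ∃ σ : Equiv.Perm (Fin 6), a = ![L, L, Y, Y, M, M] ∘ σ) → Θ a = 0) :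
    Nonempty (SVredH 0 0 ≃ₗ[ℂ] ℂ) ∧
    (SVPhiBar ∈ SVredCocycles 0 2 ∧
      (∀ c : ℂ, c • SVPhiBar ∈ SVredCoboundaries 0 2 → c = 0) ∧
      ∀ γ : SVRaw 2, γ ∈ SVredCocycles 0 2 →
        ∃ c : ℂ, γ - c • SVPhiBar ∈ SVredCoboundaries 0 2) ∧
    (SVPhi ∈ SVredCocycles 0 3 ∧
      (∀ c : ℂ, c • SVPhi ∈ SVredCoboundaries 0 3 → c = 0) ∧
      ∀ γ : SVRaw 3, γ ∈ SVredCocycles 0 3 →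
        ∃ c : ℂ, γ - c • SVPhi ∈ SVredCoboundaries 0 3) ∧
    (Λbar ∈ SVredCocycles 0 4 ∧ Ψbar ∈ SVredCocycles 0 4 ∧
      (∀ c₁ c₂ : ℂ, c₁ • Λbar + c₂ • Ψbar ∈ SVredCoboundaries 0 4 →
        c₁ = 0 ∧ c₂ = 0) ∧
      ∀ γ : SVRaw 4, γ ∈ SVredCocycles 0 4 →
        ∃ c₁ c₂ : ℂ, γ - (c₁ • Λbar + c₂ • Ψbar) ∈ SVredCoboundaries 0 4) ∧
    (Λ ∈ SVredCocycles 0 5 ∧ Ψ ∈ SVredCocycles 0 5 ∧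
      Ωbar ∈ SVredCocycles 0 5 ∧ Θbar ∈ SVredCocycles 0 5 ∧
      (∀ c₁ c₂ c₃ c₄ : ℂ,
        c₁ • Λ + c₂ • Ψ + c₃ • Ωbar + c₄ • Θbar ∈ SVredCoboundaries 0 5 →
        c₁ = 0 ∧ c₂ = 0 ∧ c₃ = 0 ∧ c₄ = 0) ∧
      ∀ γ : SVRaw 5, γ ∈ SVredCocycles 0 5 →
        ∃ c₁ c₂ c₃ c₄ : ℂ,
          γ - (c₁ • Λ + c₂ • Ψ + c₃ • Ωbar + c₄ • Θbar) ∈ SVredCoboundaries 0 5) ∧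
    (Ω ∈ SVredCocycles 0 6 ∧ Θ ∈ SVredCocycles 0 6 ∧
      (∀ c₁ c₂ : ℂ, c₁ • Ω + c₂ • Θ ∈ SVredCoboundaries 0 6 →
        c₁ = 0 ∧ c₂ = 0) ∧
      ∀ γ : SVRaw 6, γ ∈ SVredCocycles 0 6 →
        ∃ c₁ c₂ : ℂ, γ - (c₁ • Ω + c₂ • Θ) ∈ SVredCoboundaries 0 6) ∧
    (∀ q : ℕ, q = 1 ∨ 7 ≤ q → SVredCocycles 0 q ≤ SVredCoboundaries 0 q) := by
  have hΛΨ : IsBasicBasis 4 fun i => toWords 5 (![Λ, Ψ] i) := by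
    convert isBasicBasis_Λ_Ψ hΛc hΛv hΛ0 hΨc hΨv hΨ0 using 1
    exact funext (Fin.forall_fin_two.mpr ⟨rfl, rfl⟩)
  have hΩΘ : IsBasicBasis 5 fun i => toWords 6 (![Ω, Θ] i) := by
    convert isBasicBasis_Ω_Θ hΩc hΩv hΩ0 hΘc hΘv hΘ0 using 1
    exact funext (Fin.forall_fin_two.mpr ⟨rfl, rfl⟩)
  have hΦ : IsBasicBasis 2 fun i => toWords 3 (![SVPhi] i) := by
    convert isBasicBasis_SVPhi using 1
    exact funext (Fin.forall_fin_one.mpr rfl)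
  refine ⟨nonempty_SVredH_zero_equiv, ?_, ?_, ?_, ?_, ?_, ?_⟩
  · obtain ⟨-, h₁, h₂, h₃⟩ := reduced_basis isBasicBasis_two.toWords_nil hΦ (fb := ![SVPhiBar])
      (Fin.forall_fin_one.mpr exists_SVPhiBar_eq)
    refine ⟨h₁ 0, fun c h => ?_, fun γ hγ => ?_⟩
    · exact congrFun (h₂ 0 ![c] (by simpa using h)).2 0
    · obtain ⟨_, c, h⟩ := h₃ γ hγ
      exact ⟨c 0, by simpa using h⟩
  · obtain ⟨h₁, -, h₂, h₃⟩ := reduced_basis hΦ isBasicBasis_four.toWords_nil (fb := ![])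
      (fun i => i.elim0)
    refine ⟨h₁ 0, fun c h => ?_, fun γ hγ => ?_⟩
    · exact congrFun (h₂ ![c] 0 (by simpa using h)).1 0
    · obtain ⟨c, _, h⟩ := h₃ γ hγ
      exact ⟨c 0, by simpa using h⟩
  · obtain ⟨-, h₁, h₂, h₃⟩ := reduced_basis isBasicBasis_four.toWords_nil hΛΨ (fb := ![Λbar, Ψbar])
      (Fin.forall_fin_two.mpr ⟨exists_Λbar_eq hΛc hΛv hΛ0 hΛbc hΛbv hΛb0,
        exists_Ψbar_eq hΨc hΨv hΨ0 hΨbc hΨbv hΨb0⟩)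
    refine ⟨h₁ 0, h₁ 1, fun c₁ c₂ h => ?_, fun γ hγ => ?_⟩
    · have := (h₂ 0 ![c₁, c₂] (by simpa using h)).2
      exact ⟨congrFun this 0, congrFun this 1⟩
    · obtain ⟨_, c, h⟩ := h₃ γ hγ
      exact ⟨c 0, c 1, by simpa using h⟩
  · obtain ⟨h₀, h₁, h₂, h₃⟩ := reduced_basis hΛΨ hΩΘ (fb := ![Ωbar, Θbar])
      (Fin.forall_fin_two.mpr ⟨exists_Ωbar_eq hΩc hΩv hΩ0 hΩbc hΩbv hΩb0,
        exists_Θbar_eq hΘc hΘv hΘ0 hΘbc hΘbv hΘb0⟩)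
    refine ⟨h₀ 0, h₀ 1, h₁ 0, h₁ 1, fun c₁ c₂ c₃ c₄ h => ?_, fun γ hγ => ?_⟩
    · obtain ⟨h, h'⟩ := h₂ ![c₁, c₂] ![c₃, c₄] (by simpa [add_assoc] using h)
      exact ⟨congrFun h 0, congrFun h 1, congrFun h' 0, congrFun h' 1⟩
    · obtain ⟨c, c', h⟩ := h₃ γ hγ
      exact ⟨c 0, c 1, c' 0, c' 1, by simpa [add_assoc] using h⟩
  · obtain ⟨h₁, -, h₂, h₃⟩ := reduced_basis hΩΘ (isBasicBasis_of_ge le_rfl).toWords_nil (fb := ![])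
      (fun i => i.elim0)
    refine ⟨h₁ 0, h₁ 1, fun c₁ c₂ h => ?_, fun γ hγ => ?_⟩
    · have := (h₂ ![c₁, c₂] 0 (by simpa using h)).1
      exact ⟨congrFun this 0, congrFun this 1⟩
    · obtain ⟨c, _, h⟩ := h₃ γ hγ
      exact ⟨c 0, c 1, by simpa using h⟩
  · rintro q (rfl | hq)
    · exact SVredCocycles_le isBasicBasis_one isBasicBasis_two
    · obtain ⟨q, rfl⟩ := Nat.exists_eq_succ_of_ne_zero (show q ≠ 0 by omega)
      exact SVredCocycles_le (isBasicBasis_of_ge (by omega)) (isBasicBasis_of_ge (by omega))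

end SVCA
end

section
/- Define the operator τ₂ from q-cochains to (q−1)-cochains of SV with coefficients in ℂ_a by (τ₂γ)_{λ₁,…,λ_{q−1}}(a₁,…,a_{q−1}) = (−1)^{q−1} γ_{λ₁,…,λ_{q−1},λ}(a₁,…,a_{q−1},L) |_{λ=0}. Then for every q-cochain γ, ((dτ₂ + τ₂d)γ) ≡ −a·γ modulo ∂C̃^q(SV,ℂ_a), i.e., (dτ₂ + τ₂d)γ + a·γ lies in the image of the operator ∂ on q-cochains. -/
/-!
Cochain complex of the Schrödinger–Virasoro conformal algebra
`SV = ℂ[∂]L ⊕ ℂ[∂]Y ⊕ ℂ[∂]M` with coefficients in the trivial module `ℂ_a`.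

Since `SV` is a free `ℂ[∂]`-module on the generators `L, Y, M`, and since a
`q`-cochain (a `ℂ`-linear, conformally antilinear map `SV^{⊗q} → ℂ[λ₁,…,λ_q]`)
is uniquely determined by its values on `q`-tuples of generators, we model
cochains as functions from generator tuples to `ℂ[λ₁,…,λ_q]`, subject to the
skew-symmetry condition (simultaneous permutation of the entries and the
variables `λᵢ`).
-/

namespace SVCA

open MvPolynomial

open SVGen

lemma SVskip_castSucc_last {q : ℕ} (i : Fin (q + 1)) (k : Fin q) :
    SVskip i.castSucc (Fin.last (q + 1)) k = (i.succAbove k).castSucc := by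
  have h : (⟨min (i.castSucc : ℕ) q, Nat.lt_succ_of_le (Nat.min_le_right _ _)⟩ :
      Fin (q + 1)) = i := by
    ext
    simp only [Fin.val_castSucc]
    omega
  rw [SVskip, h, Fin.succAbove_last]

lemma SVskip_castSucc_castSucc {q : ℕ} {i j : Fin (q + 2)} (hij : (i : ℕ) < j)
    (k : Fin q) :
    SVskip i.castSucc j.castSucc k.castSucc = (SVskip i j k).castSucc := by
  have h : (⟨min (i.castSucc : ℕ) (q + 1), Nat.lt_succ_of_le (Nat.min_le_right _ _)⟩ :
      Fin (q + 2)) =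
      Fin.castSucc ⟨min (i : ℕ) q, Nat.lt_succ_of_le (Nat.min_le_right _ _)⟩ := by
    ext
    simp only [Fin.val_castSucc]
    omega
  rw [SVskip, h, Fin.castSucc_succAbove_castSucc, Fin.castSucc_succAbove_castSucc, SVskip]

lemma SVskip_castSucc_castSucc_last {q : ℕ} {i j : Fin (q + 2)} (hij : (i : ℕ) < j) :
    SVskip i.castSucc j.castSucc (Fin.last q) = Fin.last (q + 2) := by
  have h : (⟨min (i.castSucc : ℕ) (q + 1), Nat.lt_succ_of_le (Nat.min_le_right _ _)⟩ :
      Fin (q + 2)) =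
      Fin.castSucc ⟨min (i : ℕ) q, Nat.lt_succ_of_le (Nat.min_le_right _ _)⟩ := by
    ext
    simp only [Fin.val_castSucc]
    omega
  have hi : Fin.castSucc (⟨min (i : ℕ) q, Nat.lt_succ_of_le (Nat.min_le_right _ _)⟩ :
      Fin (q + 1)) ≠ Fin.last (q + 1) := Fin.castSucc_ne_last _
  rw [SVskip, h, Fin.succAbove_ne_last_last hi, Fin.succAbove_ne_last_last j.castSucc_ne_last]

lemma SVbrk_L_fst (x : SVGen) : (SVbrk x L).1 = x := by
  cases x <;> rfl

lemma SVbrk_L_sub (x : SVGen) : (SVbrk x L).2.2 - (SVbrk x L).2.1 = 1 := by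
  cases x <;> norm_num [SVbrk]

/-- Moving the `i`-th argument of a cochain to the front costs the sign `(-1)^i`. -/
lemma SVCochain_aeval_cons_succAbove {q : ℕ} {γ : SVRaw (q + 1)}
    (hγ : γ ∈ SVCochain (q + 1)) (t : Fin (q + 1) → SVGen) (i : Fin (q + 1)) :
    aeval (Fin.cons (X i) fun k => X (i.succAbove k) :
        Fin (q + 1) → MvPolynomial (Fin (q + 1)) ℂ)
      (γ (Fin.cons (t i) fun k => t (i.succAbove k))) = ((-1 : ℂ) ^ (i : ℕ)) • γ t := by
  have h := hγ i.cycleRange.symm t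
  have ht : t ∘ i.cycleRange.symm = Fin.cons (t i) fun k => t (i.succAbove k) := by
    funext k
    refine Fin.cases ?_ (fun k => ?_) k <;> simp
  have hX : (Fin.cons (X i) fun k => X (i.succAbove k) :
      Fin (q + 1) → MvPolynomial (Fin (q + 1)) ℂ) = X ∘ i.cycleRange.symm := by
    funext k
    refine Fin.cases ?_ (fun k => ?_) k <;> simp
  rw [ht] at h
  rw [hX]
  rw [← rename_eq_aeval, h, Equiv.Perm.sign_symm, Fin.sign_cycleRange]
  simp

/-- The terms of `τ₂(dγ)` that bracket an argument with the inserted `L`. -/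
lemma aeval_SVdTerm_castSucc_last {q : ℕ} {γ : SVRaw (q + 1)}
    (hγ : γ ∈ SVCochain (q + 1)) (t : Fin (q + 1) → SVGen) (i : Fin (q + 1)) :
    ((-1 : ℂ) ^ (q + 1)) • aeval (Fin.snoc (fun k : Fin (q + 1) => X k) 0 :
        Fin (q + 2) → MvPolynomial (Fin (q + 1)) ℂ)
      (SVdTerm γ (Fin.snoc t L) i.castSucc (Fin.last (q + 1))) = X i * γ t := by
  have hX : (fun k => aeval (Fin.snoc (fun k : Fin (q + 1) => X k) 0 :
        Fin (q + 2) → MvPolynomial (Fin (q + 1)) ℂ)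
      ((Fin.cons (X i.castSucc + X (Fin.last (q + 1))) fun k => X (i.succAbove k).castSucc :
        Fin (q + 1) → MvPolynomial (Fin (q + 2)) ℂ) k)) =
      Fin.cons (X i) fun k => X (i.succAbove k) := by
    funext k
    refine Fin.cases ?_ (fun k => ?_) k <;> simp
  have hc : (C (SVbrk (t i) L).2.2 * X i - C (SVbrk (t i) L).2.1 * X i :
      MvPolynomial (Fin (q + 1)) ℂ) = X i := by
    rw [← sub_mul, ← C_sub, SVbrk_L_sub, C_1, one_mul]
  simp only [SVdTerm, SVskip_castSucc_last, Fin.snoc_castSucc, Fin.snoc_last, SVbrk_L_fst,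
    map_smul, map_mul, map_sub, map_add, aeval_C, aeval_X, algebraMap_eq, add_zero, hc]
  rw [MvPolynomial.comp_aeval_apply, hX, SVCochain_aeval_cons_succAbove hγ t i, mul_smul_comm, smul_smul, smul_smul, Fin.val_castSucc, Fin.val_last, ← pow_add, ← pow_add,
    Even.neg_one_pow ⟨q + 1 + i, by ring⟩, one_smul]

/-- The remaining terms of `τ₂(dγ)` are the negatives of those of `d(τ₂γ)`. -/
lemma aeval_SVdTerm_castSucc_castSucc {q : ℕ} (γ : SVRaw (q + 2)) (t : Fin (q + 2) → SVGen)
    {i j : Fin (q + 2)} (hij : (i : ℕ) < j) :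
    ((-1 : ℂ) ^ (q + 2)) • aeval (Fin.snoc (fun k : Fin (q + 2) => X k) 0 :
        Fin (q + 3) → MvPolynomial (Fin (q + 2)) ℂ)
      (SVdTerm γ (Fin.snoc t L) i.castSucc j.castSucc) = -SVdTerm (SVtau2 γ) t i j := by
  have ht (x : SVGen) : (Fin.cons x fun k => (Fin.snoc t L : Fin (q + 3) → SVGen)
      (SVskip i.castSucc j.castSucc k) : Fin (q + 2) → SVGen) =
      Fin.snoc (Fin.cons x fun k => t (SVskip i j k) : Fin (q + 1) → SVGen) L := by
    rw [← Fin.cons_snoc_eq_snoc_cons]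
    congr 1
    funext k
    refine Fin.lastCases ?_ (fun k => ?_) k
    · simp [SVskip_castSucc_castSucc_last hij]
    · simp [SVskip_castSucc_castSucc hij]
  have hX : (fun k => aeval (Fin.snoc (fun k : Fin (q + 2) => X k) 0 :
        Fin (q + 3) → MvPolynomial (Fin (q + 2)) ℂ)
      ((Fin.cons (X i.castSucc + X j.castSucc) fun k => X (SVskip i.castSucc j.castSucc k) :
        Fin (q + 2) → MvPolynomial (Fin (q + 3)) ℂ) k)) =
      fun k => aeval (Fin.cons (X i + X j) fun k => X (SVskip i j k) :
        Fin (q + 1) → MvPolynomial (Fin (q + 2)) ℂ)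
      ((Fin.snoc (fun k : Fin (q + 1) => X k) 0 :
        Fin (q + 2) → MvPolynomial (Fin (q + 1)) ℂ) k) := by
    funext k
    refine Fin.cases ?_ (fun k => ?_) k
    · rw [← Fin.castSucc_zero, Fin.snoc_castSucc]
      simp
    · refine Fin.lastCases ?_ (fun k => ?_) k
      · rw [Fin.succ_last, Fin.snoc_last, ← Fin.succ_last, Fin.cons_succ,
          SVskip_castSucc_castSucc_last hij]
        simp
      · rw [Fin.succ_castSucc, Fin.snoc_castSucc, ← Fin.succ_castSucc, Fin.cons_succ,
          SVskip_castSucc_castSucc hij]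
        simp
  simp only [SVdTerm, SVtau2, ht, Fin.snoc_castSucc,
    map_smul, map_mul, map_sub, map_add, aeval_C, aeval_X, algebraMap_eq]
  rw [MvPolynomial.comp_aeval_apply, MvPolynomial.comp_aeval_apply, hX, mul_smul_comm, smul_smul, smul_smul, Fin.val_castSucc, Fin.val_castSucc, ← neg_smul]
  congr 1
  ring

lemma SVd_SVtau2_apply {q : ℕ} (γ : SVRaw (q + 1)) (t : Fin (q + 1) → SVGen) :
    SVd (SVtau2 γ) t = -∑ i : Fin (q + 1), ∑ j : Fin (q + 1),
      if (i : ℕ) < j then ((-1 : ℂ) ^ (q + 1)) •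
        aeval (Fin.snoc (fun k : Fin (q + 1) => X k) 0 :
          Fin (q + 2) → MvPolynomial (Fin (q + 1)) ℂ)
        (SVdTerm γ (Fin.snoc t L) i.castSucc j.castSucc) else 0 := by
  cases q with
  | zero => simp [SVd]
  | succ q =>
    simp only [SVd, ← Finset.sum_neg_distrib]
    refine Finset.sum_congr rfl fun i _ => Finset.sum_congr rfl fun j _ => ?_
    split_ifs with hij
    · rw [aeval_SVdTerm_castSucc_castSucc γ t hij, neg_neg]
    · rw [neg_zero]

lemma SVd_SVtau2_add_SVtau2_SVd {q : ℕ} {γ : SVRaw (q + 1)} (hγ : γ ∈ SVCochain (q + 1))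
    (t : Fin (q + 1) → SVGen) :
    SVd (SVtau2 γ) t + SVtau2 (SVd γ) t = (∑ i, X i) * γ t := by
  have h (i : Fin (q + 1)) : ¬ q + 1 < (i : ℕ) := by omega
  have hlast (i : Fin (q + 1)) : (i : ℕ) < q + 1 := i.isLt
  rw [SVd_SVtau2_apply, neg_add_eq_iff_eq_add]
  simp only [SVtau2, SVd, map_sum, Finset.smul_sum, Finset.sum_mul,
    apply_ite, map_zero, smul_zero]
  rw [Fin.sum_univ_castSucc]
  simp only [Fin.sum_univ_castSucc (n := q + 1), Fin.val_castSucc, Fin.val_last, h, hlast,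
    lt_irrefl, if_true, if_false, Finset.sum_const_zero, add_zero,
    aeval_SVdTerm_castSucc_last hγ, Finset.sum_add_distrib]

/-- The homotopy identity for the operator `τ₂` on
`q`-cochains with coefficients in `ℂ_a` (here `q ≥ 1`, and a `q`-cochain is
written as an element of `SVRaw (q+1)` with `q+1 ≥ 1`):
`(dτ₂ + τ₂d)γ ≡ -a·γ (mod ∂C̃^q(SV,ℂ_a))`, i.e. `(dτ₂ + τ₂d)γ + a·γ` lies in
the image `∂C̃^q(SV,ℂ_a)` of the operator `∂` on `q`-cochains. -/
theorem statement17 (a : ℂ) (q : ℕ) (γ : SVRaw (q + 1)) (hγ : γ ∈ SVCochain (q + 1)) :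
    SVd (SVtau2 γ) + SVtau2 (SVd γ) + a • γ ∈ SVpartialSub a (q + 1) := by
  refine ⟨γ, hγ, ?_⟩
  funext t
  simp only [SVpartial, LinearMap.coe_mk, AddHom.coe_mk, Pi.add_apply, Pi.smul_apply,
    SVd_SVtau2_add_SVtau2_SVd hγ, add_mul, C_mul']
  exact add_comm _ _

end SVCA
end
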